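/- arXiv:math/9907106 — 2 statements merged into one kernel-verified Lean document; each statement's English description precedes it below -/
import Mathlib

section
/- Let (A,R) be a minimal triangular pointed Hopf algebra over an algebraically closed field k of characteristic 0, G = G(A), f_R: A^{*cop} → A the Hopf isomorphism p ↦ (p⊗I)(R), and F: G×G → k* the non-degenerate skew-symmetric bilinear form F(g,h) := ⟨f_R⁻¹(g), h⟩. For g ∈ G let V_g be a ⟨g⟩-stable complement of sp_k{1−g} in P_{1,g}(A). Then for any g,h ∈ G, x ∈ V_g and y ∈ V_h, one has xy = F(h,g)yx. -/
open TensorProduct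

noncomputable section

universe u v w

namespace Paper

variable (k : Type*) [Field k]

section Basic

variable (A : Type*) [Ring A] [HopfAlgebra k A]

/-- `g` is a grouplike element of the Hopf algebra `A`. -/
def IsGrouplike (g : A) : Prop :=
  Coalgebra.counit (R := k) g = 1 ∧ Coalgebra.comul (R := k) g = g ⊗ₜ[k] g

/-- `x` is a `g:h` skew primitive element of `A`, i.e. `Δ(x) = x ⊗ g + h ⊗ x`. -/
def IsSkewPrimitive (g h x : A) : Prop :=
  Coalgebra.comul (R := k) x = x ⊗ₜ[k] g + h ⊗ₜ[k] x

/-- The space `P_{g,h}(A)` of `g:h` skew primitives, as a submodule. -/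
def skewPrimitives (g h : A) : Submodule k A :=
  LinearMap.ker (Coalgebra.comul (R := k) -
    ((TensorProduct.mk k A A).flip g + TensorProduct.mk k A A h))

end Basic

section Coalg

variable {M : Type*} [AddCommGroup M] [Module k M]

/-- `C` is a subcoalgebra with respect to the comultiplication `d`. -/
def IsSubcoalgebraOf (d : M →ₗ[k] M ⊗[k] M) (C : Submodule k M) : Prop :=
  ∀ x ∈ C, d x ∈ LinearMap.range (TensorProduct.map C.subtype C.subtype)

/-- `C` is a simple subcoalgebra with respect to `d`. -/
def IsSimpleSubcoalgebraOf (d : M →ₗ[k] M ⊗[k] M) (C : Submodule k M) : Prop :=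
  C ≠ ⊥ ∧ IsSubcoalgebraOf k d C ∧
    ∀ D : Submodule k M, IsSubcoalgebraOf k d D → D ≤ C → D = ⊥ ∨ D = C

/-- A coalgebra is pointed if all its simple subcoalgebras are `1`-dimensional. -/
def IsPointedOf (d : M →ₗ[k] M ⊗[k] M) : Prop :=
  ∀ C : Submodule k M, IsSimpleSubcoalgebraOf k d C → Module.finrank k C = 1

/-- The coradical: the sum of all simple subcoalgebras. -/
def coradicalOf (d : M →ₗ[k] M ⊗[k] M) : Submodule k M :=
  sSup {C | IsSimpleSubcoalgebraOf k d C}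

/-- The first term `A₁ = Δ⁻¹(A₀ ⊗ A + A ⊗ A₀)` of the coradical filtration. -/
def firstCoradicalTermOf (d : M →ₗ[k] M ⊗[k] M) : Submodule k M :=
  Submodule.comap d
    (LinearMap.range (TensorProduct.map (coradicalOf k d).subtype (LinearMap.id (M := M))) ⊔
      LinearMap.range (TensorProduct.map (LinearMap.id (M := M)) (coradicalOf k d).subtype))

end Coalg

section Hopf

variable (A : Type*) [Ring A] [HopfAlgebra k A]

/-- A Hopf algebra is pointed if all its simple subcoalgebras are `1`-dimensional. -/
def IsPointed : Prop := IsPointedOf k (Coalgebra.comul (R := k) (A := A))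

/-- A subalgebra `B` of `A` is a sub-Hopf-algebra if it is closed under
comultiplication and under the antipode. -/
def IsSubHopf (B : Subalgebra k A) : Prop :=
  (∀ x ∈ B, Coalgebra.comul (R := k) x ∈
      LinearMap.range (TensorProduct.map B.toSubmodule.subtype B.toSubmodule.subtype)) ∧
  ∀ x ∈ B, HopfAlgebra.antipode (R := k) x ∈ B

/-- `r` belongs to `K ⊗ K ⊆ A ⊗ A` for a submodule `K` of `A`. -/
def MemTensorSquare (K : Submodule k A) (r : A ⊗[k] A) : Prop :=
  r ∈ LinearMap.range (TensorProduct.map K.subtype K.subtype)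

/-- `(Δ ⊗ id)(r) = r₁₃ r₂₃`. -/
def Hexagon₁ (r : A ⊗[k] A) : Prop :=
  Algebra.TensorProduct.map (Bialgebra.comulAlgHom k A) (AlgHom.id k A) r =
    Algebra.TensorProduct.map (Algebra.TensorProduct.includeLeft (R := k) (S := k)) (AlgHom.id k A) r *
      Algebra.TensorProduct.map (Algebra.TensorProduct.includeRight (R := k)) (AlgHom.id k A) r

/-- `(id ⊗ Δ)(r) = r₁₃ r₁₂`. -/
def Hexagon₂ (r : A ⊗[k] A) : Prop :=
  Algebra.TensorProduct.map (AlgHom.id k A) (Bialgebra.comulAlgHom k A) r =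
    Algebra.TensorProduct.map (AlgHom.id k A) (Algebra.TensorProduct.includeRight (R := k)) r *
      Algebra.TensorProduct.map (AlgHom.id k A) (Algebra.TensorProduct.includeLeft (R := k) (S := k)) r

/-- The Drinfeld element `u = Σ S(R⁽²⁾) R⁽¹⁾` associated to an element `r ∈ A ⊗ A`. -/
def drinfeldOf (r : A ⊗[k] A) : A :=
  LinearMap.mul' k A
    ((TensorProduct.map (HopfAlgebra.antipode (R := k)) LinearMap.id)
      ((TensorProduct.comm k A A) r))

/-- A quasitriangular structure on the Hopf algebra `A`. -/
structure QuasiTriangular where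
  /-- the R-matrix -/
  R : A ⊗[k] A
  isUnit : IsUnit R
  intertwine : ∀ a : A,
    (TensorProduct.comm k A A) (Coalgebra.comul (R := k) a) * R = R * Coalgebra.comul (R := k) a
  hexagon₁ : Hexagon₁ k A R
  hexagon₂ : Hexagon₂ k A R

variable {A}

/-- A quasitriangular Hopf algebra is triangular if `R R₂₁ = 1 ⊗ 1`. -/
def QuasiTriangular.IsTriangular (Q : QuasiTriangular k A) : Prop :=
  Q.R * (TensorProduct.comm k A A) Q.R = 1

/-- `(A,R)` is minimal if no proper sub-Hopf-algebra contains the components of `R`. -/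
def QuasiTriangular.IsMinimal (Q : QuasiTriangular k A) : Prop :=
  ∀ B : Subalgebra k A, IsSubHopf k A B → MemTensorSquare k A B.toSubmodule Q.R → B = ⊤

/-- The Drinfeld element of a quasitriangular Hopf algebra. -/
def QuasiTriangular.drinfeld (Q : QuasiTriangular k A) : A := drinfeldOf k A Q.R

/-- The map `f_R : A* → A`, `p ↦ (p ⊗ I)(R)`. -/
def fR (Q : QuasiTriangular k A) : Module.Dual k A →ₗ[k] A :=
  TensorProduct.lift
    (LinearMap.mk₂ k (fun a b => (Module.Dual.eval k A a).smulRight b)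
      (fun a a' b => by ext p; simp [add_smul])
      (fun c a b => by ext p; simp [smul_smul])
      (fun a b b' => by ext p; simp [smul_add])
      (fun c a b => by ext p; simp [smul_comm (p a) c b])) Q.R

/-- Radford's coinvariants `B = {x ∈ A | (I ⊗ π)Δ(x) = x ⊗ 1}` of a projection `π`. -/
def coinvariants (π : A →ₗ[k] A) : Submodule k A :=
  LinearMap.ker
    ((TensorProduct.map LinearMap.id π) ∘ₗ Coalgebra.comul (R := k) -
      (TensorProduct.mk k A A).flip 1)

end Hopf


section Complements

variable (A : Type*) [Ring A] [HopfAlgebra k A]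

/-- Radford's projection `Π : A → B`, `Π(a) = Σ a₁ · S(π(a₂))`, associated to a Hopf
algebra projection `π`; it projects `A` onto the coinvariants `B`. -/
def radfordPi (π : A →ₗ[k] A) : A →ₗ[k] A :=
  LinearMap.mul' k A ∘ₗ
    TensorProduct.map LinearMap.id (HopfAlgebra.antipode (R := k) ∘ₗ π) ∘ₗ
      Coalgebra.comul (R := k)

/-- `π : A → A` is a Hopf algebra projection of `A` onto `K = k[G(A)]`, the span of the
grouplike elements: it is a coalgebra map, its range is `K` and it restricts to the
identity on `K`. -/
def IsHopfProjectionOntoGrouplikes (π : A →ₐ[k] A) : Prop :=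
  (∀ x : A, Coalgebra.comul (R := k) (π x) =
    TensorProduct.map π.toLinearMap π.toLinearMap (Coalgebra.comul (R := k) x)) ∧
  (∀ x : A, Coalgebra.counit (R := k) (π x) = Coalgebra.counit (R := k) x) ∧
  LinearMap.range π.toLinearMap = Submodule.span k {g : A | IsGrouplike k A g} ∧
  (∀ x ∈ Submodule.span k {g : A | IsGrouplike k A g}, π x = x)

/-- `V` is a `⟨g⟩`-stable (under conjugation) complement of `sp_k{1−g}` in
`P_{1,g}(A)`. -/
def IsConjStableComplement (g : A) (V : Submodule k A) : Prop :=
  V ≤ skewPrimitives k A 1 g ∧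
  Disjoint (Submodule.span k {(1 : A) - g}) V ∧
  Submodule.span k {(1 : A) - g} ⊔ V = skewPrimitives k A 1 g ∧
  ∀ x ∈ V, g * x * HopfAlgebra.antipode (R := k) g ∈ V

end Complements

section Slices

variable {k}
variable {A : Type*} [Ring A] [HopfAlgebra k A]

/-- The slice map `p ⊗ id : A ⊗ A → A`. -/
def leftSlice (p : Module.Dual k A) : A ⊗[k] A →ₗ[k] A :=
  (TensorProduct.lid k A).toLinearMap ∘ₗ LinearMap.rTensor A p

/-- The slice map `id ⊗ q : A ⊗ A → A`. -/
def rightSlice (q : Module.Dual k A) : A ⊗[k] A →ₗ[k] A :=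
  (TensorProduct.rid k A).toLinearMap ∘ₗ LinearMap.lTensor A q

@[simp] lemma leftSlice_tmul (p : Module.Dual k A) (a b : A) :
    leftSlice p (a ⊗ₜ[k] b) = p a • b := by
  simp [leftSlice]

@[simp] lemma rightSlice_tmul (q : Module.Dual k A) (a b : A) :
    rightSlice q (a ⊗ₜ[k] b) = q b • a := by
  simp [rightSlice]

lemma apply_leftSlice (p q : Module.Dual k A) (r : A ⊗[k] A) :
    q (leftSlice p r) = p (rightSlice q r) := by
  induction r with
  | zero => simp
  | tmul a b => simp [mul_comm]
  | add r s hr hs => simp [hr, hs]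

lemma leftSlice_comm (p : Module.Dual k A) (r : A ⊗[k] A) :
    leftSlice p (TensorProduct.comm k A A r) = rightSlice p r := by
  induction r with
  | zero => simp
  | tmul a b => simp
  | add r s hr hs => simp [hr, hs]

lemma rightSlice_comm (p : Module.Dual k A) (r : A ⊗[k] A) :
    rightSlice p (TensorProduct.comm k A A r) = leftSlice p r := by
  induction r with
  | zero => simp
  | tmul a b => simp
  | add r s hr hs => simp [hr, hs]

lemma leftSlice_map (p : Module.Dual k A) (f g : A →ₗ[k] A) (r : A ⊗[k] A) :
    leftSlice p (TensorProduct.map f g r) = g (leftSlice (p ∘ₗ f) r) := by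
  induction r with
  | zero => simp
  | tmul a b => simp
  | add r s hr hs => simp [hr, hs]

lemma rightSlice_map (p : Module.Dual k A) (f g : A →ₗ[k] A) (r : A ⊗[k] A) :
    rightSlice p (TensorProduct.map f g r) = f (rightSlice (p ∘ₗ g) r) := by
  induction r with
  | zero => simp
  | tmul a b => simp
  | add r s hr hs => simp [hr, hs]

lemma leftSlice_tmul_mul (p : Module.Dual k A) (b c : A) (r : A ⊗[k] A) :
    leftSlice p ((b ⊗ₜ c) * r) = c * leftSlice (p ∘ₗ LinearMap.mulLeft k b) r := by
  induction r with
  | zero => simp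
  | tmul a b => simp
  | add r s hr hs => simp [mul_add, hr, hs]

lemma leftSlice_mul_tmul (p : Module.Dual k A) (b c : A) (r : A ⊗[k] A) :
    leftSlice p (r * (b ⊗ₜ c)) = leftSlice (p ∘ₗ LinearMap.mulRight k b) r * c := by
  induction r with
  | zero => simp
  | tmul a b => simp
  | add r s hr hs => simp [add_mul, hr, hs]

lemma leftSlice_sub (p q : Module.Dual k A) (r : A ⊗[k] A) :
    leftSlice (p - q) r = leftSlice p r - leftSlice q r := by
  simp [leftSlice, LinearMap.rTensor_sub]

/-- Functionals of the form `p ⊗ q` separate the points of `A ⊗ A`. -/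
lemma eq_of_apply_leftSlice {r s : A ⊗[k] A}
    (h : ∀ p q : Module.Dual k A, q (leftSlice p r) = q (leftSlice p s)) : r = s := by
  let b := Module.Free.chooseBasis k A
  have key : ∀ (t : A ⊗[k] A) i j,
      (b.tensorProduct b).repr t (i, j) = b.coord j (leftSlice (b.coord i) t) := by
    intro t i j
    induction t with
    | zero => simp
    | tmul a c => simp [mul_comm]
    | add x y hx hy => simp only [map_add, Finsupp.add_apply, hx, hy]
  refine (b.tensorProduct b).ext_elem fun ⟨i, j⟩ ↦ ?_
  rw [key, key, h]

/-- A tensor lies in `K ⊗ K` as soon as it is annihilated by all functionals `p ⊗ q` such that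
`p` or `q` vanishes on `K`. -/
lemma mem_range_map_subtype {K : Submodule k A} {r : A ⊗[k] A}
    (hl : ∀ p q : Module.Dual k A, (∀ x ∈ K, p x = 0) → q (leftSlice p r) = 0)
    (hr : ∀ p q : Module.Dual k A, (∀ x ∈ K, q x = 0) → q (leftSlice p r) = 0) :
    r ∈ LinearMap.range (TensorProduct.map K.subtype K.subtype) := by
  obtain ⟨P, hP⟩ := LinearMap.exists_leftInverse_of_injective K.subtype K.ker_subtype
  have hP' : ∀ x ∈ K, (P x : A) = x := fun x hx ↦
    congrArg Subtype.val (LinearMap.congr_fun hP ⟨x, hx⟩)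
  refine ⟨TensorProduct.map P P r, ?_⟩
  rw [← LinearMap.comp_apply, ← TensorProduct.map_comp]
  refine eq_of_apply_leftSlice fun p q ↦ ?_
  set π := K.subtype ∘ₗ P
  have h₁ := hl (p - p ∘ₗ π) q fun x hx ↦ by simp [π, hP' x hx]
  have h₂ := hr (p ∘ₗ π) (q - q ∘ₗ π) fun x hx ↦ by simp [π, hP' x hx]
  rw [leftSlice_map]
  simp only [leftSlice_sub, map_sub, LinearMap.sub_apply, LinearMap.comp_apply, sub_eq_zero]
    at h₁ h₂
  rw [h₁, h₂]

/-- The convolution product of two functionals. -/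
def conv (p q : Module.Dual k A) : Module.Dual k A :=
  q ∘ₗ leftSlice p ∘ₗ Coalgebra.comul

lemma conv_apply (p q : Module.Dual k A) (a : A) :
    conv p q a = q (leftSlice p (Coalgebra.comul a)) := rfl

end Slices

section Quasitriangular

variable {k}
variable {A : Type*} [Ring A] [HopfAlgebra k A] (Q : QuasiTriangular k A)

lemma fR_apply (p : Module.Dual k A) : fR k Q p = leftSlice p Q.R := by
  unfold fR
  induction Q.R with
  | zero => simp
  | tmul a b => simp
  | add r s hr hs => simp [hr, hs]

/-- The map `q ↦ (I ⊗ q)(R)`. -/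
def fR' : Module.Dual k A →ₗ[k] A where
  toFun q := rightSlice q Q.R
  map_add' p q := by simp [rightSlice, LinearMap.lTensor_add]
  map_smul' c q := by simp [rightSlice, LinearMap.lTensor_smul]

lemma fR'_apply (q : Module.Dual k A) : fR' Q q = rightSlice q Q.R := rfl

lemma apply_fR (p q : Module.Dual k A) : q (fR k Q p) = p (fR' Q q) := by
  rw [fR_apply, fR'_apply, apply_leftSlice]

lemma fR_conv (p q : Module.Dual k A) : fR k Q (conv p q) = fR k Q p * fR k Q q := by
  let Φ : (A ⊗[k] A) ⊗[k] A →ₗ[k] A :=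
    (TensorProduct.lid k A).toLinearMap ∘ₗ LinearMap.rTensor A (q ∘ₗ leftSlice p)
  have h := congrArg Φ Q.hexagon₁
  have hl : ∀ r : A ⊗[k] A,
      Φ (Algebra.TensorProduct.map (Bialgebra.comulAlgHom k A) (AlgHom.id k A) r) =
        leftSlice (conv p q) r := by
    intro r
    induction r with
    | zero => simp
    | tmul a b => simp [Φ, conv]
    | add r s hr hs => simp [hr, hs]
  have hr : ∀ r s : A ⊗[k] A,
      Φ (Algebra.TensorProduct.map (Algebra.TensorProduct.includeLeft (R := k) (S := k))
          (AlgHom.id k A) r *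
        Algebra.TensorProduct.map (Algebra.TensorProduct.includeRight (R := k))
          (AlgHom.id k A) s) = leftSlice p r * leftSlice q s := by
    intro r s
    induction r with
    | zero => simp
    | add r₁ r₂ h₁ h₂ => simp [add_mul, h₁, h₂]
    | tmul a b =>
      induction s with
      | zero => simp
      | add s₁ s₂ h₁ h₂ => simp only [map_add, mul_add, h₁, h₂]
      | tmul c d => simp [Φ, smul_smul, mul_comm]
  rw [hl, hr] at h
  simpa only [fR_apply] using h

lemma apply_comul_fR (p q r : Module.Dual k A) :
    r (leftSlice q (Coalgebra.comul (fR k Q p))) = p (fR' Q r * fR' Q q) := by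
  let Φ : A ⊗[k] (A ⊗[k] A) →ₗ[k] k :=
    p ∘ₗ (TensorProduct.rid k A).toLinearMap ∘ₗ LinearMap.lTensor A (r ∘ₗ leftSlice q)
  have h := congrArg Φ Q.hexagon₂
  have hl : ∀ s : A ⊗[k] A,
      Φ (Algebra.TensorProduct.map (AlgHom.id k A) (Bialgebra.comulAlgHom k A) s) =
        r (leftSlice q (Coalgebra.comul (leftSlice p s))) := by
    intro s
    induction s with
    | zero => simp
    | tmul a b => simp [Φ, mul_comm]
    | add s t hs ht => simp [hs, ht]
  have hr : ∀ s t : A ⊗[k] A,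
      Φ (Algebra.TensorProduct.map (AlgHom.id k A)
          (Algebra.TensorProduct.includeRight (R := k)) s *
        Algebra.TensorProduct.map (AlgHom.id k A)
          (Algebra.TensorProduct.includeLeft (R := k) (S := k)) t) =
        p (rightSlice r s * rightSlice q t) := by
    intro s t
    induction s with
    | zero => simp
    | add r₁ r₂ h₁ h₂ => simp only [map_add, add_mul, h₁, h₂]
    | tmul a b =>
      induction t with
      | zero => simp
      | add s₁ s₂ h₁ h₂ => simp only [map_add, mul_add, h₁, h₂]
      | tmul c d => simp [Φ]; ring
  rw [hl, hr] at h
  simpa only [fR_apply, fR'_apply] using h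

lemma leftSlice_counit_comul (a : A) :
    leftSlice (Coalgebra.counit (R := k)) (Coalgebra.comul a) = a := by
  simp [leftSlice]

lemma counit_conv (p : Module.Dual k A) : conv Coalgebra.counit p = p := by
  ext a
  rw [conv_apply, leftSlice_counit_comul]

lemma fR_counit : fR k Q Coalgebra.counit = 1 := by
  have h : (1 ⊗ₜ fR k Q Coalgebra.counit) * Q.R = 1 * Q.R := by
    refine eq_of_apply_leftSlice fun p q ↦ ?_
    rw [leftSlice_tmul_mul, LinearMap.mulLeft_one, LinearMap.comp_id, one_mul, ← fR_apply,
      ← fR_conv, counit_conv]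
  simpa [Algebra.TensorProduct.one_def] using
    congrArg (leftSlice (Coalgebra.counit (R := k))) (Q.isUnit.mul_right_cancel h)

lemma fR'_counit : fR' Q Coalgebra.counit = 1 := by
  have h : Q.R * (fR' Q Coalgebra.counit ⊗ₜ 1) = Q.R * 1 := by
    refine eq_of_apply_leftSlice fun p q ↦ ?_
    rw [leftSlice_mul_tmul, mul_one, mul_one, ← fR_apply, ← fR_apply, apply_fR,
      LinearMap.comp_apply, LinearMap.mulRight_apply, ← apply_comul_fR, leftSlice_counit_comul]
  simpa [Algebra.TensorProduct.one_def] using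
    congrArg (rightSlice (Coalgebra.counit (R := k))) (Q.isUnit.mul_left_cancel h)

lemma map_antipode_mul_self :
    TensorProduct.map (HopfAlgebra.antipode k) LinearMap.id Q.R * Q.R = 1 := by
  let Φ : (A ⊗[k] A) ⊗[k] A →ₗ[k] A ⊗[k] A :=
    LinearMap.rTensor A (LinearMap.mul' k A ∘ₗ LinearMap.rTensor A (HopfAlgebra.antipode k))
  have h := congrArg Φ Q.hexagon₁
  have hl : ∀ r : A ⊗[k] A,
      Φ (Algebra.TensorProduct.map (Bialgebra.comulAlgHom k A) (AlgHom.id k A) r) =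
        1 ⊗ₜ leftSlice Coalgebra.counit r := by
    intro r
    induction r with
    | zero => simp
    | tmul a b => simp [Φ, Algebra.algebraMap_eq_smul_one, TensorProduct.smul_tmul]
    | add r s hr hs => simp [hr, hs, TensorProduct.tmul_add]
  have hr : ∀ r s : A ⊗[k] A,
      Φ (Algebra.TensorProduct.map (Algebra.TensorProduct.includeLeft (R := k) (S := k))
          (AlgHom.id k A) r *
        Algebra.TensorProduct.map (Algebra.TensorProduct.includeRight (R := k))
          (AlgHom.id k A) s) =
        TensorProduct.map (HopfAlgebra.antipode k) LinearMap.id r * s := by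
    intro r s
    induction r with
    | zero => simp
    | add r₁ r₂ h₁ h₂ => simp only [map_add, add_mul, h₁, h₂]
    | tmul a b =>
      induction s with
      | zero => simp
      | add s₁ s₂ h₁ h₂ => simp only [map_add, mul_add, h₁, h₂]
      | tmul c d => simp [Φ]
  rw [hl, hr, ← fR_apply, fR_counit] at h
  exact h.symm

variable {Q}

lemma map_antipode_eq_comm (htri : Q.IsTriangular) :
    TensorProduct.map (HopfAlgebra.antipode k) LinearMap.id Q.R = TensorProduct.comm k A A Q.R :=
  left_inv_eq_right_inv (map_antipode_mul_self Q) htri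

lemma fR'_eq (htri : Q.IsTriangular) (p : Module.Dual k A) :
    fR' Q p = fR k Q (p ∘ₗ HopfAlgebra.antipode k) := by
  rw [fR'_apply, ← leftSlice_comm, ← map_antipode_eq_comm htri, leftSlice_map, fR_apply,
    LinearMap.id_apply]

lemma fR_eq (htri : Q.IsTriangular) (p : Module.Dual k A) :
    fR k Q p = HopfAlgebra.antipode k (fR' Q p) := by
  rw [fR_apply, ← rightSlice_comm, ← map_antipode_eq_comm htri, rightSlice_map, fR'_apply,
    LinearMap.comp_id]

variable (Q) in
lemma finite_range_fR' : Module.Finite k (LinearMap.range (fR' Q)) := by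
  have key : ∀ r : A ⊗[k] A, ∃ M : Submodule k A, M.FG ∧ ∀ q, rightSlice q r ∈ M := by
    intro r
    induction r with
    | zero => exact ⟨⊥, Submodule.fg_bot, by simp⟩
    | tmul a b =>
      refine ⟨k ∙ a, Submodule.fg_span_singleton a, fun q ↦ ?_⟩
      rw [rightSlice_tmul]
      exact Submodule.smul_mem _ _ (Submodule.mem_span_singleton_self a)
    | add r s hr hs =>
      obtain ⟨M, hM, hr⟩ := hr
      obtain ⟨N, hN, hs⟩ := hs
      refine ⟨M ⊔ N, hM.sup hN, fun q ↦ ?_⟩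
      rw [map_add]
      exact Submodule.add_mem_sup (hr q) (hs q)
  obtain ⟨M, hM, h⟩ := key Q.R
  have : Module.Finite k M := .of_fg hM
  exact Submodule.finiteDimensional_of_le (S₂ := M) (by rintro _ ⟨q, rfl⟩; exact h q)

lemma range_fR'_eq_range_fR (htri : Q.IsTriangular) :
    LinearMap.range (fR' Q) = LinearMap.range (fR k Q) := by
  have := finite_range_fR' Q
  have h : LinearMap.range (fR k Q) =
      (LinearMap.range (fR' Q)).map (HopfAlgebra.antipode k) := by
    rw [← LinearMap.range_comp]
    exact congrArg _ (LinearMap.ext (fR_eq htri))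
  have hfin : Module.Finite k (LinearMap.range (fR k Q)) := by
    rw [h]
    infer_instance
  refine Submodule.eq_of_le_of_finrank_le ?_ ?_
  · rintro _ ⟨p, rfl⟩
    exact ⟨_, (fR'_eq htri p).symm⟩
  · rw [h]
    exact Submodule.finrank_map_le _ _

/-- The components of the `R`-matrix of a minimal triangular Hopf algebra `A` span `A`. -/
lemma fR_surjective (htri : Q.IsTriangular) (hmin : Q.IsMinimal) :
    Function.Surjective (fR k Q) := by
  have hrange := range_fR'_eq_range_fR htri
  have hfR' : ∀ q : Module.Dual k A, (∀ x ∈ LinearMap.range (fR k Q), q x = 0) →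
      fR' Q q = 0 := by
    intro q hq
    refine Module.forall_dual_apply_eq_zero_iff k _ |>.1 fun p ↦ ?_
    rw [← apply_fR]
    exact hq _ ⟨p, rfl⟩
  have hfR : ∀ p : Module.Dual k A, (∀ x ∈ LinearMap.range (fR k Q), p x = 0) →
      fR k Q p = 0 := by
    intro p hp
    refine Module.forall_dual_apply_eq_zero_iff k _ |>.1 fun q ↦ ?_
    rw [apply_fR]
    exact hp _ (hrange ▸ ⟨q, rfl⟩)
  let B : Subalgebra k A :=
    { carrier := LinearMap.range (fR k Q)
      mul_mem' := by
        rintro _ _ ⟨p, rfl⟩ ⟨q, rfl⟩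
        exact ⟨conv p q, fR_conv Q p q⟩
      add_mem' := add_mem
      algebraMap_mem' := fun c ↦
        ⟨c • Coalgebra.counit, by rw [map_smul, fR_counit, Algebra.algebraMap_eq_smul_one]⟩ }
  have hB : B = ⊤ := by
    refine hmin B ⟨?_, ?_⟩ ?_
    · rintro _ ⟨p, rfl⟩
      refine mem_range_map_subtype (fun q r hq ↦ ?_) (fun q r hr ↦ ?_)
      · rw [apply_comul_fR, hfR' q hq, mul_zero, map_zero]
      · rw [apply_comul_fR, hfR' r hr, zero_mul, map_zero]
    · rintro x (hx : x ∈ LinearMap.range (fR k Q))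
      obtain ⟨p, rfl⟩ := hrange ▸ hx
      exact ⟨p, fR_eq htri p⟩
    · refine mem_range_map_subtype (fun p q hp ↦ ?_) (fun p q hq ↦ ?_)
      · rw [← fR_apply, hfR p hp, map_zero]
      · rw [apply_leftSlice, ← fR'_apply, hfR' q hq, map_zero]
  intro a
  exact (hB ▸ Algebra.mem_top : a ∈ B)

lemma fR'_surjective (htri : Q.IsTriangular) (hmin : Q.IsMinimal) :
    Function.Surjective (fR' Q) := by
  rw [← LinearMap.range_eq_top, range_fR'_eq_range_fR htri, LinearMap.range_eq_top]
  exact fR_surjective htri hmin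

lemma fR_injective (htri : Q.IsTriangular) (hmin : Q.IsMinimal) :
    Function.Injective (fR k Q) := by
  rw [injective_iff_map_eq_zero]
  intro p hp
  ext a
  obtain ⟨q, rfl⟩ := fR'_surjective htri hmin a
  rw [← apply_fR, hp, map_zero, LinearMap.zero_apply]

lemma finite_of_isMinimal (htri : Q.IsTriangular) (hmin : Q.IsMinimal) : Module.Finite k A := by
  have := finite_range_fR' Q
  rw [LinearMap.range_eq_top.2 (fR'_surjective htri hmin)] at this
  exact Module.Finite.equiv Submodule.topEquiv

end Quasitriangular

section GroupLike

variable {k}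
variable {A : Type*} [Ring A] [HopfAlgebra k A]

lemma exists_dual_groupLike {h : A} (hh : IsGroupLikeElem k h) :
    ∃ p : Module.Dual k A, p h = 1 ∧ ∀ h', IsGroupLikeElem k h' → h' ≠ h → p h' = 0 := by
  have hlin : LinearIndepOn k id {a : A | IsGroupLikeElem k a} := linearIndepOn_isGroupLikeElem
  obtain ⟨p, hp, hker⟩ := Submodule.exists_le_ker_of_notMem (hlin.notMem_span hh)
  refine ⟨(p h)⁻¹ • p, by simpa using inv_mul_cancel₀ hp, fun h' hh' hne ↦ ?_⟩
  have : p h' = 0 := hker (Submodule.subset_span ⟨h', ⟨hh', hne⟩, rfl⟩)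
  simp [this]

lemma counit_eq_zero_of_comul {g x : A} (hg : IsGroupLikeElem k g)
    (hx : Coalgebra.comul (R := k) x = x ⊗ₜ 1 + g ⊗ₜ x) : Coalgebra.counit (R := k) x = 0 := by
  have h := leftSlice_counit_comul (k := k) x
  rw [hx, map_add, leftSlice_tmul, leftSlice_tmul, hg.counit_eq_one, one_smul,
    add_eq_right] at h
  simpa using congrArg (Coalgebra.counit (R := k)) h

/-- A skew primitive element in the span of the grouplikes is trivial. -/
lemma mem_span_one_sub_of_mem_span {g x : A} (hg : IsGroupLikeElem k g)
    (hx : Coalgebra.comul (R := k) x = x ⊗ₜ 1 + g ⊗ₜ x)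
    (hmem : x ∈ Submodule.span k {a : A | IsGroupLikeElem k a}) :
    x ∈ Submodule.span k {1 - g} := by
  obtain ⟨c, hc, hsum⟩ := Submodule.mem_span_set.1 hmem
  have hsupp : ∀ h ∈ c.support, h = 1 ∨ h = g := by
    intro h hh
    by_contra! hne
    obtain ⟨p, hp, hp'⟩ := exists_dual_groupLike (k := k) (hc hh)
    have hspan : ∀ y ∈ Submodule.span k {a : A | IsGroupLikeElem k a}, conv p p y = p y := by
      refine LinearMap.eqOn_span' fun h' (hh' : IsGroupLikeElem k h') ↦ ?_
      rw [conv_apply, hh'.comul_eq_tmul_self, leftSlice_tmul, map_smul, smul_eq_mul]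
      rcases eq_or_ne h' h with rfl | hne'
      · rw [hp, mul_one]
      · rw [hp' h' hh' hne', mul_zero]
    have hpx : p x = c h := by
      rw [← hsum, Finsupp.sum, map_sum, Finset.sum_eq_single h]
      · simp [hp]
      · intro h' hh' hne'
        simp [hp' h' (hc hh') hne']
      · intro hn
        exact absurd hh hn
    have h0 := hspan x hmem
    rw [conv_apply, hx, map_add, leftSlice_tmul, leftSlice_tmul, hp' g hg hne.2.symm, zero_smul,
      add_zero, map_smul, hp' 1 .one hne.1.symm, smul_zero, hpx] at h0
    exact Finsupp.mem_support_iff.1 hh h0.symm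
  have hmem' : x ∈ Submodule.span k {1, g} := by
    rw [← hsum]
    refine Submodule.sum_mem _ fun h hh ↦ Submodule.smul_mem _ _ (Submodule.subset_span ?_)
    exact hsupp h hh
  obtain ⟨a, b, rfl⟩ := Submodule.mem_span_pair.1 hmem'
  have hab := counit_eq_zero_of_comul hg hx
  simp only [map_add, map_smul, Bialgebra.counit_one, hg.counit_eq_one, smul_eq_mul,
    mul_one] at hab
  refine Submodule.mem_span_singleton.2 ⟨a, ?_⟩
  rw [eq_neg_of_add_eq_zero_right hab, smul_sub, neg_smul, sub_eq_add_neg]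

/-- The span of the products `γ xⁱ` with `γ` grouplike and `i < n`. -/
def powSpan (k : Type*) [Field k] {A : Type*} [Ring A] [HopfAlgebra k A] (x : A) (n : ℕ) :
    Submodule k A :=
  Submodule.span k {a | ∃ γ : A, IsGroupLikeElem k γ ∧ ∃ i < n, γ * x ^ i = a}

lemma mul_pow_mem_powSpan (x : A) {γ : A} (hγ : IsGroupLikeElem k γ) {i n : ℕ} (hi : i < n) :
    γ * x ^ i ∈ powSpan k x n :=
  Submodule.subset_span ⟨γ, hγ, i, hi, rfl⟩

lemma exists_pow_mem_powSpan [Module.Finite k A] (x : A) : ∃ n, x ^ n ∈ powSpan k x n := by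
  obtain ⟨f, hf, h0⟩ := Algebra.IsIntegral.isIntegral (R := k) x
  refine ⟨f.natDegree, ?_⟩
  rw [hf.as_sum, ← Polynomial.aeval_def] at h0
  simp only [map_add, map_sum, map_mul, map_pow, Polynomial.aeval_X, Polynomial.aeval_C] at h0
  rw [eq_neg_of_add_eq_zero_left h0]
  refine neg_mem (sum_mem fun i hi ↦ ?_)
  rw [← Algebra.smul_def, ← one_mul (x ^ i)]
  exact Submodule.smul_mem _ _ (mul_pow_mem_powSpan x .one (Finset.mem_range.1 hi))

lemma comul_mul_pow {g x γ : A} (hγ : IsGroupLikeElem k γ)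
    (hx : Coalgebra.comul (R := k) x = x ⊗ₜ 1 + g ⊗ₜ x) (hgx : Commute g x) (i : ℕ) :
    Coalgebra.comul (R := k) (γ * x ^ i) = ∑ m ∈ Finset.range (i + 1),
      (i.choose m : k) • ((γ * g ^ (i - m) * x ^ m) ⊗ₜ[k] (γ * x ^ (i - m))) := by
  have hcomm : Commute (x ⊗ₜ[k] (1 : A)) (g ⊗ₜ[k] x) := by
    simp [Commute, SemiconjBy, hgx.eq]
  rw [Bialgebra.comul_mul, Bialgebra.comul_pow, hx, hcomm.add_pow, hγ.comul_eq_tmul_self,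
    Finset.mul_sum]
  refine Finset.sum_congr rfl fun m _ ↦ ?_
  rw [← nsmul_eq_mul', mul_smul_comm, ← Nat.cast_smul_eq_nsmul k]
  simp [Algebra.TensorProduct.tmul_pow, mul_assoc, ((hgx.pow_pow (i - m) m)).eq]

/-- In a finite-dimensional Hopf algebra in characteristic zero, a `(1, g)`-skew primitive element
commuting with `g` is trivial. -/
lemma mem_span_one_sub_of_commute [CharZero k] [Module.Finite k A] {g x : A}
    (hg : IsGroupLikeElem k g) (hx : Coalgebra.comul (R := k) x = x ⊗ₜ 1 + g ⊗ₜ x)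
    (hgx : Commute g x) : x ∈ Submodule.span k {1 - g} := by
  classical
  have hspan : powSpan k x 1 ≤ Submodule.span k {a : A | IsGroupLikeElem k a} := by
    refine Submodule.span_le.2 ?_
    rintro _ ⟨γ, hγ, i, hi, rfl⟩
    obtain rfl : i = 0 := by omega
    rw [pow_zero, mul_one]
    exact Submodule.subset_span hγ
  refine mem_span_one_sub_of_mem_span hg hx (hspan ?_)
  by_contra hx1
  have hex := exists_pow_mem_powSpan (k := k) x
  obtain ⟨n, hn, hmin⟩ : ∃ n, x ^ n ∈ powSpan k x n ∧ ∀ m < n, x ^ m ∉ powSpan k x m :=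
    ⟨Nat.find hex, Nat.find_spec hex, fun m hm ↦ Nat.find_min hex hm⟩
  have hn0 : n ≠ 0 := by
    rintro rfl
    have h1 : (1 : A) = 0 := by simpa [powSpan] using hn
    exact (IsGroupLikeElem.one (R := k) (A := A)).ne_zero h1
  have hn1 : n ≠ 1 := by
    rintro rfl
    exact hx1 (by simpa using hn)
  obtain ⟨n, rfl⟩ : ∃ N, n = N + 2 := ⟨n - 2, by omega⟩
  have hgn : g * x ^ (n + 1) ∉ powSpan k x (n + 1) := by
    intro hmem
    refine hmin (n + 1) (by omega) ?_
    have hle : powSpan k x (n + 1) ≤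
        (powSpan k x (n + 1)).comap (LinearMap.mulLeft k (HopfAlgebra.antipode k g)) := by
      refine Submodule.span_le.2 ?_
      rintro _ ⟨γ, hγ, i, hi, rfl⟩
      change HopfAlgebra.antipode k g * (γ * x ^ i) ∈ powSpan k x (n + 1)
      rw [← mul_assoc]
      exact mul_pow_mem_powSpan x (hg.antipode.mul hγ) hi
    have := hle hmem
    rwa [Submodule.mem_comap, LinearMap.mulLeft_apply, ← mul_assoc, hg.antipode_mul_cancel,
      one_mul] at this
  obtain ⟨p, hp, hp'⟩ := Submodule.exists_le_ker_of_notMem hgn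
  obtain ⟨q, hq, hq'⟩ := Submodule.exists_le_ker_of_notMem hx1
  have hpker : ∀ {γ}, IsGroupLikeElem k γ → ∀ m < n + 1, p (γ * x ^ m) = 0 :=
    fun hγ m hm ↦ hp' (mul_pow_mem_powSpan x hγ hm)
  have hqker : ∀ {γ}, IsGroupLikeElem k γ → q γ = 0 := fun {γ} hγ ↦ by
    have := hq' (mul_pow_mem_powSpan x hγ zero_lt_one)
    rwa [pow_zero, mul_one] at this
  have hterm : ∀ {γ}, IsGroupLikeElem k γ → ∀ i, conv p q (γ * x ^ i) =
      ∑ m ∈ Finset.range (i + 1),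
        (i.choose m : k) * (p (γ * g ^ (i - m) * x ^ m) * q (γ * x ^ (i - m))) := by
    intro γ hγ i
    rw [conv_apply, comul_mul_pow hγ hx hgx, map_sum, map_sum]
    simp
  have hzero : powSpan k x (n + 2) ≤ LinearMap.ker (conv p q) := by
    refine Submodule.span_le.2 ?_
    rintro _ ⟨γ, hγ, i, hi, rfl⟩
    refine (hterm hγ i).trans (Finset.sum_eq_zero fun m hm ↦ ?_)
    have hm := Finset.mem_range.1 hm
    rcases lt_or_ge m (n + 1) with hlt | hge
    · rw [hpker (hγ.mul hg.pow) m hlt, zero_mul, mul_zero]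
    · rw [show i - m = 0 by omega, pow_zero, pow_zero, mul_one, hqker hγ, mul_zero,
        mul_zero]
  have htop := hterm .one (n + 2)
  rw [one_mul, LinearMap.mem_ker.1 (hzero hn), Finset.sum_range_succ, Finset.sum_range_succ,
    Finset.sum_eq_zero fun m hm ↦ ?_] at htop
  · simp only [Nat.choose_self, tsub_self, pow_zero, hqker .one, one_mul, mul_zero, add_zero,
      zero_add, show n + 2 - (n + 1) = 1 by omega, pow_one,
      show (n + 2).choose (n + 1) = n + 2 from Nat.choose_succ_self_right (n + 1)] at htop
    exact mul_ne_zero (Nat.cast_ne_zero.2 (by omega)) (mul_ne_zero hp hq) htop.symm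
  · rw [hpker (IsGroupLikeElem.one.mul hg.pow) m (Finset.mem_range.1 hm), zero_mul, mul_zero]

lemma finite_groupLike [Module.Finite k A] : Finite (GroupLike k A) := by
  have h : {a : A | IsGroupLikeElem k a}.Finite :=
    (linearIndepOn_isGroupLikeElem (R := k) (A := A)).linearIndependent.setFinite
  have : Finite {a : A // IsGroupLikeElem k a} := h
  exact .of_equiv _ GroupLike.valEquiv.symm

/-- In characteristic zero, a unipotent grouplike element of a finite-dimensional Hopf algebra
is trivial. -/
lemma eq_one_of_isNilpotent_sub_one [CharZero k] [Module.Finite k A] {a : A}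
    (ha : IsGroupLikeElem k a) (hnil : IsNilpotent (a - 1)) : a = 1 := by
  have := finite_groupLike (k := k) (A := A)
  obtain ⟨N, hN, hpow⟩ :=
    isOfFinOrder_iff_pow_eq_one.1 (isOfFinOrder_of_finite (⟨a, ha⟩ : GroupLike k A))
  replace hpow : a ^ N = 1 := congrArg GroupLike.val hpow
  set s := ∑ j ∈ Finset.range N, ∑ i ∈ Finset.range j, a ^ i
  have hs : ∑ j ∈ Finset.range N, a ^ j = algebraMap k A N + s * (a - 1) := by
    rw [Finset.sum_mul, Finset.sum_congr rfl fun j _ ↦ geom_sum_mul a j]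
    simp
  have hcomm : Commute s (a - 1) :=
    .sum_left _ _ _ fun j _ ↦ .sum_left _ _ _ fun i _ ↦
      ((Commute.refl a).pow_left i).sub_right (.one_right _)
  have hunit : IsUnit (∑ j ∈ Finset.range N, a ^ j) := by
    rw [hs]
    refine (hcomm.isNilpotent_mul_left hnil).isUnit_add_left_of_commute ?_
      (Algebra.commutes _ _).symm
    exact (IsUnit.mk0 (N : k) (Nat.cast_ne_zero.2 hN.ne')).map _
  have hmul := geom_sum_mul a N
  rw [hpow, sub_self] at hmul
  exact sub_eq_zero.1 (hunit.mul_right_eq_zero.1 hmul)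

end GroupLike

section Braiding

variable {k}
variable {A : Type*} [Ring A] [HopfAlgebra k A] {Q : QuasiTriangular k A}

lemma apply_one (p : Module.Dual k A) : p 1 = Coalgebra.counit (R := k) (fR k Q p) := by
  rw [apply_fR, fR'_counit]

lemma apply_one_of_fR {p : Module.Dual k A} (hp : IsGroupLikeElem k (fR k Q p)) : p 1 = 1 := by
  rw [apply_one (Q := Q), hp.counit_eq_one]

lemma counit_fR' (p : Module.Dual k A) : Coalgebra.counit (R := k) (fR' Q p) = p 1 := by
  rw [← apply_fR, fR_counit]

/-- A functional corresponding to a grouplike element is multiplicative. -/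
lemma apply_mul_of_fR (htri : Q.IsTriangular) (hmin : Q.IsMinimal) {p : Module.Dual k A}
    (hp : IsGroupLikeElem k (fR k Q p)) (a b : A) : p (a * b) = p a * p b := by
  obtain ⟨q, rfl⟩ := fR'_surjective htri hmin a
  obtain ⟨r, rfl⟩ := fR'_surjective htri hmin b
  rw [← apply_comul_fR, hp.comul_eq_tmul_self, leftSlice_tmul, map_smul, smul_eq_mul, apply_fR,
    apply_fR, mul_comm]

/-- A functional corresponding to a skew primitive element is a skew derivation. -/
lemma apply_mul_of_fR_skewPrimitive (htri : Q.IsTriangular) (hmin : Q.IsMinimal)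
    {p ξ : Module.Dual k A}
    (hξ : Coalgebra.comul (R := k) (fR k Q ξ) = fR k Q ξ ⊗ₜ 1 + fR k Q p ⊗ₜ fR k Q ξ) (a b : A) :
    ξ (a * b) = Coalgebra.counit (R := k) a * ξ b + p b * ξ a := by
  obtain ⟨q, rfl⟩ := fR'_surjective htri hmin a
  obtain ⟨r, rfl⟩ := fR'_surjective htri hmin b
  rw [← apply_comul_fR, hξ, map_add, leftSlice_tmul, leftSlice_tmul, map_add, map_smul, map_smul,
    smul_eq_mul, smul_eq_mul, apply_fR, apply_fR, apply_fR, counit_fR']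
  ring

lemma fR_mul_fR' (htri : Q.IsTriangular) (hmin : Q.IsMinimal) {p : Module.Dual k A}
    (hp : IsGroupLikeElem k (fR k Q p)) : fR k Q p * fR' Q p = 1 := by
  have key : ∀ r s : A ⊗[k] A, leftSlice p (r * s) = leftSlice p r * leftSlice p s := by
    intro r s
    induction r with
    | zero => simp
    | add r₁ r₂ h₁ h₂ => simp only [map_add, add_mul, h₁, h₂]
    | tmul a b =>
      induction s with
      | zero => simp
      | add s₁ s₂ h₁ h₂ => simp only [map_add, mul_add, h₁, h₂]
      | tmul c d => simp [apply_mul_of_fR htri hmin hp, smul_smul, mul_comm]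
  have h := congrArg (leftSlice p) htri
  rwa [key, leftSlice_comm, ← fR_apply, ← fR'_apply, Algebra.TensorProduct.one_def,
    leftSlice_tmul, apply_one_of_fR hp, one_smul] at h

lemma fR'_eq_antipode (htri : Q.IsTriangular) (hmin : Q.IsMinimal) {p : Module.Dual k A}
    (hp : IsGroupLikeElem k (fR k Q p)) : fR' Q p = HopfAlgebra.antipode k (fR k Q p) :=
  (left_inv_eq_right_inv hp.antipode_mul_cancel (fR_mul_fR' htri hmin hp)).symm

lemma apply_mul_antipode (htri : Q.IsTriangular) (hmin : Q.IsMinimal) {p : Module.Dual k A}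
    (hp : IsGroupLikeElem k (fR k Q p)) {u : A} (hu : IsGroupLikeElem k u) :
    p u * p (HopfAlgebra.antipode k u) = 1 := by
  rw [← apply_mul_of_fR htri hmin hp, hu.mul_antipode_cancel, apply_one_of_fR hp]

lemma apply_ne_zero (htri : Q.IsTriangular) (hmin : Q.IsMinimal) {p : Module.Dual k A}
    (hp : IsGroupLikeElem k (fR k Q p)) {u : A} (hu : IsGroupLikeElem k u) : p u ≠ 0 :=
  left_ne_zero_of_mul_eq_one (apply_mul_antipode htri hmin hp hu)

/-- The form on grouplike elements induced by `R` is skew-symmetric. -/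
lemma apply_fR_mul_apply_fR (htri : Q.IsTriangular) (hmin : Q.IsMinimal) {p q : Module.Dual k A}
    (hp : IsGroupLikeElem k (fR k Q p)) (hq : IsGroupLikeElem k (fR k Q q)) :
    p (fR k Q q) * q (fR k Q p) = 1 := by
  rw [apply_fR Q p q, fR'_eq_antipode htri hmin hq]
  exact apply_mul_antipode htri hmin hp hq

lemma apply_fR_eq_antipode (htri : Q.IsTriangular) (hmin : Q.IsMinimal) {p : Module.Dual k A}
    (hp : IsGroupLikeElem k (fR k Q p)) (ξ : Module.Dual k A) :
    p (fR k Q ξ) = ξ (HopfAlgebra.antipode k (fR k Q p)) := by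
  rw [apply_fR, fR'_eq_antipode htri hmin hp]

variable (Q) in
lemma leftSlice_intertwine (p : Module.Dual k A) (a : A) :
    leftSlice p (TensorProduct.comm k A A (Coalgebra.comul a) * Q.R) =
      leftSlice p (Q.R * Coalgebra.comul a) :=
  congrArg (leftSlice p) (Q.intertwine a)

lemma comp_mulLeft_of_fR (htri : Q.IsTriangular) (hmin : Q.IsMinimal) {p : Module.Dual k A}
    (hp : IsGroupLikeElem k (fR k Q p)) (b : A) : p ∘ₗ LinearMap.mulLeft k b = p b • p := by
  ext a
  exact apply_mul_of_fR htri hmin hp b a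

lemma comp_mulRight_of_fR (htri : Q.IsTriangular) (hmin : Q.IsMinimal) {p : Module.Dual k A}
    (hp : IsGroupLikeElem k (fR k Q p)) (b : A) : p ∘ₗ LinearMap.mulRight k b = p b • p := by
  ext a
  exact (apply_mul_of_fR htri hmin hp a b).trans (mul_comm _ _)

lemma comp_mulLeft_of_fR_skewPrimitive (htri : Q.IsTriangular) (hmin : Q.IsMinimal)
    {p ξ : Module.Dual k A}
    (hξ : Coalgebra.comul (R := k) (fR k Q ξ) = fR k Q ξ ⊗ₜ 1 + fR k Q p ⊗ₜ fR k Q ξ) (b : A) :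
    ξ ∘ₗ LinearMap.mulLeft k b = Coalgebra.counit (R := k) b • ξ + ξ b • p := by
  ext a
  simp [apply_mul_of_fR_skewPrimitive htri hmin hξ, mul_comm]

lemma comp_mulRight_of_fR_skewPrimitive (htri : Q.IsTriangular) (hmin : Q.IsMinimal)
    {p ξ : Module.Dual k A}
    (hξ : Coalgebra.comul (R := k) (fR k Q ξ) = fR k Q ξ ⊗ₜ 1 + fR k Q p ⊗ₜ fR k Q ξ) (b : A) :
    ξ ∘ₗ LinearMap.mulRight k b = ξ b • Coalgebra.counit (R := k) + p b • ξ := by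
  ext a
  simp [apply_mul_of_fR_skewPrimitive htri hmin hξ, mul_comm]

lemma mul_comm_of_isGroupLikeElem (htri : Q.IsTriangular) (hmin : Q.IsMinimal) {u v : A}
    (hu : IsGroupLikeElem k u) (hv : IsGroupLikeElem k v) : u * v = v * u := by
  obtain ⟨p, rfl⟩ := fR_surjective htri hmin v
  have h := leftSlice_intertwine Q p u
  rw [hu.comul_eq_tmul_self, TensorProduct.comm_tmul, leftSlice_tmul_mul, leftSlice_mul_tmul,
    comp_mulLeft_of_fR htri hmin hv, comp_mulRight_of_fR htri hmin hv, ← fR_apply, map_smul,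
    mul_smul_comm, smul_mul_assoc] at h
  exact smul_right_injective A (apply_ne_zero htri hmin hv hu) h

/-- The commutation relation between a skew primitive and a grouplike element. -/
lemma skewPrimitive_mul_groupLike (htri : Q.IsTriangular) (hmin : Q.IsMinimal)
    {p ξ : Module.Dual k A}
    (hξ : Coalgebra.comul (R := k) (fR k Q ξ) = fR k Q ξ ⊗ₜ 1 + fR k Q p ⊗ₜ fR k Q ξ)
    {u : A} (hu : IsGroupLikeElem k u) :
    u * fR k Q ξ + ξ u • (u * fR k Q p) = ξ u • u + p u • (fR k Q ξ * u) := by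
  have h := leftSlice_intertwine Q ξ u
  rwa [hu.comul_eq_tmul_self, TensorProduct.comm_tmul, leftSlice_tmul_mul, leftSlice_mul_tmul,
    comp_mulLeft_of_fR_skewPrimitive htri hmin hξ, comp_mulRight_of_fR_skewPrimitive htri hmin hξ,
    ← fR_apply, ← fR_apply, map_add, map_add, map_smul, map_smul, map_smul, map_smul, fR_counit,
    hu.counit_eq_one, one_smul, mul_add, add_mul, mul_smul_comm, smul_mul_assoc, smul_mul_assoc,
    one_mul] at h

/-- The commutation relation between two skew primitive elements. -/
lemma skewPrimitive_mul_skewPrimitive (htri : Q.IsTriangular) (hmin : Q.IsMinimal)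
    {p ξ : Module.Dual k A} (hp : IsGroupLikeElem k (fR k Q p))
    (hξ : Coalgebra.comul (R := k) (fR k Q ξ) = fR k Q ξ ⊗ₜ 1 + fR k Q p ⊗ₜ fR k Q ξ)
    {h y : A} (hh : IsGroupLikeElem k h)
    (hy : Coalgebra.comul (R := k) y = y ⊗ₜ 1 + h ⊗ₜ y) :
    y * fR k Q ξ + ξ y • (h * fR k Q p) =
      ξ y • 1 + p y • fR k Q ξ + (ξ h • y + p h • (fR k Q ξ * y)) := by
  have hξ1 : ξ 1 = 0 := by
    rw [apply_one (Q := Q), counit_eq_zero_of_comul hp hξ]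
  have e := leftSlice_intertwine Q ξ y
  rw [hy] at e
  simp only [map_add, add_mul, mul_add, TensorProduct.comm_tmul, leftSlice_tmul_mul,
    leftSlice_mul_tmul, comp_mulLeft_of_fR_skewPrimitive htri hmin hξ,
    comp_mulRight_of_fR_skewPrimitive htri hmin hξ, ← fR_apply, map_smul, fR_counit,
    one_smul, one_mul, mul_one, smul_mul_assoc, mul_smul_comm, hξ1,
    counit_eq_zero_of_comul hh hy, zero_smul, zero_add, add_zero, Bialgebra.counit_one] at e
  exact e

end Braiding

section Pointed

variable {k}
variable {A : Type*} [Ring A] [HopfAlgebra k A] {Q : QuasiTriangular k A}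

lemma leftSlice_mem_of_mem_range {D : Submodule k A} {t : A ⊗[k] A}
    (ht : t ∈ LinearMap.range (TensorProduct.map D.subtype D.subtype)) (p : Module.Dual k A) :
    leftSlice p t ∈ D := by
  obtain ⟨s, rfl⟩ := ht
  induction s with
  | zero => simp
  | tmul a b => simpa using D.smul_mem _ b.2
  | add s₁ s₂ h₁ h₂ => rw [map_add, map_add]; exact D.add_mem h₁ h₂

lemma leftSlice_eq_zero_of_mem_range {D : Submodule k A} {t : A ⊗[k] A}
    (ht : t ∈ LinearMap.range (TensorProduct.map D.subtype D.subtype)) {p : Module.Dual k A}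
    (hp : ∀ x ∈ D, p x = 0) : leftSlice p t = 0 := by
  obtain ⟨s, rfl⟩ := ht
  induction s with
  | zero => simp
  | tmul a b => simp [hp a a.2]
  | add s₁ s₂ h₁ h₂ => rw [map_add, map_add, h₁, h₂, add_zero]

lemma exists_groupLike_of_finrank_eq_one {C : Submodule k A} (hC : Module.finrank k C = 1)
    (hsub : IsSubcoalgebraOf k (Coalgebra.comul (R := k) (A := A)) C) :
    ∃ c, IsGroupLikeElem k c ∧ C = k ∙ c := by
  obtain ⟨⟨v, hv⟩, hv0, hspan⟩ := finrank_eq_one_iff'.1 hC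
  replace hv0 : v ≠ 0 := fun h ↦ hv0 (Subtype.ext h)
  have hCv : C = k ∙ v := by
    refine le_antisymm (fun w hw ↦ ?_) (by simpa using hv)
    obtain ⟨c, hc⟩ := hspan ⟨w, hw⟩
    exact Submodule.mem_span_singleton.2 ⟨c, congrArg Subtype.val hc⟩
  obtain ⟨l, hl⟩ : ∃ l : k, Coalgebra.comul (R := k) v = l • (v ⊗ₜ[k] v) := by
    obtain ⟨s, hs⟩ := hsub v hv
    rw [← hs]
    clear hs
    induction s with
    | zero => exact ⟨0, by simp⟩
    | add s₁ s₂ h₁ h₂ =>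
      obtain ⟨l₁, h₁⟩ := h₁
      obtain ⟨l₂, h₂⟩ := h₂
      exact ⟨l₁ + l₂, by rw [map_add, h₁, h₂, add_smul]⟩
    | tmul a b =>
      obtain ⟨c, rfl⟩ := hspan a
      obtain ⟨d, rfl⟩ := hspan b
      exact ⟨c * d, by simp [smul_tmul', tmul_smul, smul_smul, mul_comm]⟩
  have hcounit : l * Coalgebra.counit (R := k) v = 1 := by
    have h := leftSlice_counit_comul (k := k) v
    rw [hl, map_smul, leftSlice_tmul, smul_smul] at h
    exact smul_left_injective k hv0 (h.trans (one_smul k v).symm)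
  have hl0 : l ≠ 0 := left_ne_zero_of_mul_eq_one hcounit
  refine ⟨l • v, ⟨by simpa using hcounit, ?_⟩, ?_⟩
  · rw [map_smul, hl, TensorProduct.smul_tmul_smul, smul_smul]
  · rw [hCv, Submodule.span_singleton_smul_eq hl0.isUnit]

/-- If `A` is pointed, then `f_R(p)` vanishes in every simple quotient of `A` whenever `p` vanishes
on grouplike elements. -/
lemma map_fR_eq_zero (htri : Q.IsTriangular) (hmin : Q.IsMinimal) (hpointed : IsPointed k A)
    {M : Type*} [Ring M] [Algebra k M] [IsSimpleRing M] (π : A →ₐ[k] M)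
    (hπ : Function.Surjective π) {p : Module.Dual k A}
    (hp : ∀ c, IsGroupLikeElem k c → p c = 0) : π (fR k Q p) = 0 := by
  have := finite_of_isMinimal htri hmin
  let φ : Module.Dual k A →ₗ[k] M := π.toLinearMap ∘ₗ fR k Q
  have hφ : Function.Surjective φ := hπ.comp (fR_surjective htri hmin)
  have hφmul : ∀ p q, φ (conv p q) = φ p * φ q := fun p q ↦ by simp [φ, fR_conv]
  have hφone : φ Coalgebra.counit = 1 := by simp [φ, fR_counit]
  set W : Submodule k (Module.Dual k A) := LinearMap.ker φ
  set C : Submodule k A := W.dualCoannihilator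
  have hWC : C.dualAnnihilator = W := Subspace.dualCoannihilator_dualAnnihilator_eq
  have hmemW : ∀ {q : Module.Dual k A}, (∀ x ∈ C, q x = 0) → φ q = 0 := fun {q} hq ↦ by
    rw [← LinearMap.mem_ker]
    change q ∈ W
    rwa [← hWC, Submodule.mem_dualAnnihilator]
  have hCmem : ∀ {x}, x ∈ C ↔ ∀ q, φ q = 0 → q x = 0 := Submodule.mem_dualCoannihilator _
  have hsub : IsSubcoalgebraOf k (Coalgebra.comul (R := k) (A := A)) C := by
    intro x hx
    refine mem_range_map_subtype (fun q r hq ↦ ?_) (fun q r hr ↦ ?_)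
    · exact hCmem.1 hx (conv q r) (by rw [hφmul, hmemW hq, zero_mul])
    · exact hCmem.1 hx (conv q r) (by rw [hφmul, hmemW hr, mul_zero])
  have hsimple : IsSimpleSubcoalgebraOf k (Coalgebra.comul (R := k) (A := A)) C := by
    refine ⟨?_, hsub, fun D hD hDC ↦ ?_⟩
    · intro hbot
      have : φ Coalgebra.counit = 0 := hmemW (by simp [hbot])
      rw [hφone] at this
      exact one_ne_zero this
    · let J : TwoSidedIdeal M := TwoSidedIdeal.mk' (D.dualAnnihilator.map φ : Set M)
        (zero_mem _) add_mem neg_mem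
        (by
          rintro m _ ⟨q, hq, rfl⟩
          obtain ⟨r, rfl⟩ := hφ m
          refine ⟨conv r q, ?_, hφmul r q⟩
          refine (Submodule.mem_dualAnnihilator _).2 fun x hx ↦ ?_
          exact (Submodule.mem_dualAnnihilator _).1 hq _ (leftSlice_mem_of_mem_range (hD x hx) r))
        (by
          rintro _ m ⟨q, hq, rfl⟩
          obtain ⟨r, rfl⟩ := hφ m
          refine ⟨conv q r, ?_, hφmul q r⟩
          refine (Submodule.mem_dualAnnihilator _).2 fun x hx ↦ ?_
          rw [conv_apply, leftSlice_eq_zero_of_mem_range (hD x hx)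
            ((Submodule.mem_dualAnnihilator _).1 hq), map_zero])
      have hJ : ∀ {m}, m ∈ J ↔ m ∈ D.dualAnnihilator.map φ := by
        intro m
        simp [J, TwoSidedIdeal.mem_mk']
      rcases eq_bot_or_eq_top J with h | h
      · right
        refine le_antisymm hDC ?_
        rw [← Subspace.dualAnnihilator_dualCoannihilator_eq (W := D)]
        refine Submodule.dualCoannihilator_anti fun q hq ↦ ?_
        have : φ q ∈ J := hJ.2 ⟨q, hq, rfl⟩
        rwa [h, TwoSidedIdeal.mem_bot] at this
      · left
        obtain ⟨q, hq, hq1⟩ := hJ.1 (h ▸ TwoSidedIdeal.mem_top M : (1 : M) ∈ J)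
        rw [← hφone, ← sub_eq_zero, ← map_sub] at hq1
        rw [Submodule.eq_bot_iff]
        have hcounit : ∀ x ∈ D, Coalgebra.counit (R := k) x = 0 := fun x hx ↦ by
          have h1 := hCmem.1 (hDC hx) _ hq1
          rwa [LinearMap.sub_apply, (Submodule.mem_dualAnnihilator _).1 hq x hx, zero_sub,
            neg_eq_zero] at h1
        intro x hx
        rw [← leftSlice_counit_comul (k := k) x, leftSlice_eq_zero_of_mem_range (hD x hx) hcounit]
  obtain ⟨c, hc, hCc⟩ := exists_groupLike_of_finrank_eq_one (hpointed C hsimple) hsub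
  refine hmemW fun x hx ↦ ?_
  rw [hCc] at hx
  obtain ⟨a, rfl⟩ := Submodule.mem_span_singleton.1 hx
  rw [map_smul, hp c hc, smul_zero]

/-- A grouplike element `f_R(p)` is trivial if `p` is trivial on grouplike elements. -/
lemma fR_eq_one [CharZero k] (htri : Q.IsTriangular) (hmin : Q.IsMinimal)
    (hpointed : IsPointed k A) {p : Module.Dual k A} (hp : IsGroupLikeElem k (fR k Q p))
    (hp' : ∀ c, IsGroupLikeElem k c → p c = 1) : fR k Q p = 1 := by
  have := finite_of_isMinimal htri hmin
  have := IsArtinianRing.of_finite k A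
  refine eq_one_of_isNilpotent_sub_one hp ?_
  have hmem : fR k Q p - 1 ∈ Ring.jacobson A := by
    obtain ⟨n, D, d, _, _, hd, ⟨e⟩⟩ :=
      IsSemisimpleRing.exists_algEquiv_pi_matrix_divisionRing k (A ⧸ Ring.jacobson A)
    rw [← Ideal.Quotient.eq_zero_iff_mem, ← e.map_eq_zero_iff]
    funext i
    rw [← fR_counit Q, ← map_sub]
    exact map_fR_eq_zero htri hmin hpointed
      (((Pi.evalAlgHom k _ i).comp e.toAlgHom).comp (Ideal.Quotient.mkₐ k _))
      ((Function.surjective_eval i).comp (e.surjective.comp Ideal.Quotient.mk_surjective))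
      fun c hc ↦ by rw [LinearMap.sub_apply, hp' c hc, hc.counit_eq_one, sub_self]
  obtain ⟨N, hN⟩ := IsSemiprimaryRing.isNilpotent (R := A)
  refine ⟨N, ?_⟩
  have h := Ideal.pow_mem_pow hmem N
  rw [hN] at h
  exact h

end Pointed

section Complements

variable {k}
variable {A : Type*} [Ring A] [HopfAlgebra k A] {Q : QuasiTriangular k A}

lemma IsGrouplike.isGroupLikeElem {g : A} (hg : IsGrouplike k A g) : IsGroupLikeElem k g :=
  ⟨hg.1, hg.2⟩

lemma IsConjStableComplement.comul_eq {g x : A} {V : Submodule k A}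
    (hV : IsConjStableComplement k A g V) (hx : x ∈ V) :
    Coalgebra.comul (R := k) x = x ⊗ₜ 1 + g ⊗ₜ x :=
  sub_eq_zero.1 (LinearMap.mem_ker.1 (hV.1 hx))

lemma IsConjStableComplement.eq_zero {g x : A} {V : Submodule k A}
    (hV : IsConjStableComplement k A g V) (hx : x ∈ V) (hx' : x ∈ Submodule.span k {1 - g}) :
    x = 0 :=
  Submodule.disjoint_def.1 hV.2.1 x hx' hx

/-- Elements of a stable complement are eigenvectors under conjugation. -/
lemma IsConjStableComplement.mul_eq_smul (htri : Q.IsTriangular) (hmin : Q.IsMinimal)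
    {p ξ : Module.Dual k A} (hp : IsGroupLikeElem k (fR k Q p)) {V : Submodule k A}
    (hV : IsConjStableComplement k A (fR k Q p) V) (hξ : fR k Q ξ ∈ V) :
    fR k Q p * fR k Q ξ = p (fR k Q p) • (fR k Q ξ * fR k Q p) := by
  set g := fR k Q p
  set x := fR k Q ξ
  have hrel : g * x + ξ g • (g * g) = ξ g • g + p g • (x * g) :=
    skewPrimitive_mul_groupLike htri hmin (hV.comul_eq hξ) hp
  have h := congrArg (· * HopfAlgebra.antipode k g) hrel
  simp only [add_mul, smul_mul_assoc, mul_assoc, hp.mul_antipode_cancel, mul_one] at h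
  rw [← mul_assoc] at h
  have hdiff : g * x * HopfAlgebra.antipode k g - p g • x = ξ g • (1 - g) := by
    rw [smul_sub, sub_eq_sub_iff_add_eq_add, h]
  have hzero := hV.eq_zero (V.sub_mem (hV.2.2.2 x hξ) (V.smul_mem (p g) hξ))
    (hdiff ▸ Submodule.smul_mem _ _ (Submodule.mem_span_singleton_self _))
  have h' := congrArg (· * g) (sub_eq_zero.1 hzero)
  simpa only [mul_assoc, hp.antipode_mul_cancel, mul_one, smul_mul_assoc] using h'

/-- Functionals corresponding to elements of a stable complement vanish on grouplike elements. -/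
lemma IsConjStableComplement.apply_eq_zero [CharZero k] (htri : Q.IsTriangular)
    (hmin : Q.IsMinimal) {p ξ : Module.Dual k A} (hp : IsGroupLikeElem k (fR k Q p))
    {V : Submodule k A} (hV : IsConjStableComplement k A (fR k Q p) V) (hξ : fR k Q ξ ∈ V)
    {u : A} (hu : IsGroupLikeElem k u) : ξ u = 0 := by
  have := finite_of_isMinimal htri hmin
  have hgx := hV.mul_eq_smul htri hmin hp hξ
  by_cases hc : p (fR k Q p) = 1
  · rw [hc, one_smul] at hgx
    have hx := hV.eq_zero hξ (mem_span_one_sub_of_commute hp (hV.comul_eq hξ) hgx)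
    rw [← map_zero (fR k Q)] at hx
    rw [fR_injective htri hmin hx, LinearMap.zero_apply]
  have hrel := skewPrimitive_mul_groupLike htri hmin (hV.comul_eq hξ) hu
  have hcomm := mul_comm_of_isGroupLikeElem htri hmin hu hp
  set g := fR k Q p
  set x := fR k Q ξ
  have hgux : g * (u * x) = p g • (u * x * g) := by
    rw [← mul_assoc, ← hcomm, mul_assoc, hgx, mul_smul_comm, mul_assoc]
  have hgxu : g * (x * u) = p g • (x * u * g) := by
    rw [← mul_assoc, hgx, smul_mul_assoc, mul_assoc, ← hcomm, mul_assoc]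
  have h₁ := congrArg (g * ·) hrel
  have h₂ := congrArg (fun a ↦ p g • (a * g)) hrel
  simp only [mul_add, add_mul, smul_add, mul_smul_comm, smul_mul_assoc, hgux, hgxu] at h₁ h₂
  rw [← mul_assoc, ← hcomm, smul_comm (p u) (p g)] at h₁
  have h₃ : ((1 - p g) * ξ u) • (u * g * g - u * g) = 0 := by
    have := congrArg₂ (· - ·) h₁ h₂
    simp only [add_sub_add_left_eq_sub, add_sub_add_right_eq_sub] at this
    rw [smul_sub, sub_mul, one_mul, sub_smul, sub_smul, mul_smul, mul_smul, ← sub_eq_zero.2 this]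
  rcases smul_eq_zero.1 h₃ with h | h
  · exact (mul_eq_zero.1 h).resolve_left (sub_ne_zero.2 (Ne.symm hc))
  · refine absurd ?_ hc
    have hg1 : g = 1 := by
      have hug := (hu.mul hp).isUnit
      exact hug.mul_left_cancel (by rw [sub_eq_zero.1 h, mul_one])
    rw [hg1, apply_one_of_fR hp]

lemma IsConjStableComplement.mul_eq_smul_mul [CharZero k] (htri : Q.IsTriangular)
    (hmin : Q.IsMinimal) (hpointed : IsPointed k A) {p q ξ η : Module.Dual k A}
    (hp : IsGroupLikeElem k (fR k Q p)) (hq : IsGroupLikeElem k (fR k Q q))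
    {V W : Submodule k A} (hV : IsConjStableComplement k A (fR k Q p) V)
    (hW : IsConjStableComplement k A (fR k Q q) W) (hξ : fR k Q ξ ∈ V) (hη : fR k Q η ∈ W) :
    fR k Q ξ * fR k Q η = q (fR k Q p) • (fR k Q η * fR k Q ξ) := by
  have hξ0 : ∀ {u}, IsGroupLikeElem k u → ξ u = 0 := hV.apply_eq_zero htri hmin hp hξ
  have hpη : p (fR k Q η) = 0 := by
    rw [apply_fR_eq_antipode htri hmin hp, hW.apply_eq_zero htri hmin hq hη hp.antipode]
  have hcorr : ξ (fR k Q η) • (fR k Q q * fR k Q p) = ξ (fR k Q η) • (1 : A) := by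
    by_cases h0 : ξ (fR k Q η) = 0
    · rw [h0, zero_smul, zero_smul]
    have hpair : ∀ u, IsGroupLikeElem k u → q u * p u = 1 := by
      intro u hu
      have hrel := skewPrimitive_mul_groupLike htri hmin (hW.comul_eq hη) hu
      rw [hW.apply_eq_zero htri hmin hq hη hu, zero_smul, zero_smul, add_zero, zero_add] at hrel
      have h := congrArg ξ hrel
      rw [map_smul, apply_mul_of_fR_skewPrimitive htri hmin (hV.comul_eq hξ),
        apply_mul_of_fR_skewPrimitive htri hmin (hV.comul_eq hξ), hξ0 hu, hu.counit_eq_one,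
        one_mul, mul_zero, mul_zero, add_zero, zero_add, smul_eq_mul, ← mul_assoc] at h
      exact (right_eq_mul₀ h0).1 h
    rw [← fR_conv, fR_eq_one (p := conv q p) htri hmin hpointed]
    · rw [fR_conv]
      exact hq.mul hp
    · intro u hu
      rw [conv_apply, hu.comul_eq_tmul_self, leftSlice_tmul, map_smul, smul_eq_mul, hpair u hu]
  have hrel := skewPrimitive_mul_skewPrimitive htri hmin hp (hV.comul_eq hξ) hq (hW.comul_eq hη)
  rw [hcorr, hpη, hξ0 hq, zero_smul, zero_smul, add_zero, zero_add, add_comm, add_right_inj] at hrel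
  rw [hrel, smul_smul, apply_fR_mul_apply_fR htri hmin hq hp, one_smul]

end Complements

/-- Let `(A,R)` be a minimal triangular pointed Hopf algebra over an
algebraically closed field `k` of characteristic `0`, `G = G(A)`,
`f_R : A^{*cop} → A` the Hopf isomorphism `p ↦ (p ⊗ I)(R)`, and `F : G × G → k*` the
non-degenerate skew-symmetric bilinear form `F(g,h) = ⟨f_R⁻¹(g), h⟩`. For `g ∈ G` let
`V_g` be a `⟨g⟩`-stable complement of `sp_k{1−g}` in `P_{1,g}(A)`. Then for any
`g, h ∈ G`, `x ∈ V_g` and `y ∈ V_h`, one has `xy = F(h,g) yx`. -/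
theorem complement_commutation_rule
    (k : Type u) [Field k] [IsAlgClosed k] [CharZero k]
    (A : Type v) [Ring A] [HopfAlgebra k A]
    (Q : QuasiTriangular k A) (htri : Q.IsTriangular) (hmin : Q.IsMinimal)
    (hpointed : IsPointed k A)
    (F : A → A → k)
    (hFdef : ∀ g h : A, IsGrouplike k A g → IsGrouplike k A h →
      ∀ p : Module.Dual k A, fR k Q p = g → F g h = p h) :
    ∀ g h : A, IsGrouplike k A g → IsGrouplike k A h →
      ∀ Vg Vh : Submodule k A,
        IsConjStableComplement k A g Vg → IsConjStableComplement k A h Vh →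
          ∀ x ∈ Vg, ∀ y ∈ Vh, x * y = F h g • (y * x) := by
  intro g h hg hh Vg Vh hVg hVh x hx y hy
  obtain ⟨p, rfl⟩ := fR_surjective htri hmin g
  obtain ⟨q, rfl⟩ := fR_surjective htri hmin h
  obtain ⟨ξ, rfl⟩ := fR_surjective htri hmin x
  obtain ⟨η, rfl⟩ := fR_surjective htri hmin y
  rw [hFdef _ _ hh hg q rfl]
  exact hVg.mul_eq_smul_mul htri hmin hpointed hg.isGroupLikeElem hh.isGroupLikeElem hVh hx hy

end Paper
end
end

section
/- Let (A,R) be a minimal triangular pointed Hopf algebra over an algebraically closed field k of characteristic 0, G = G(A), f_R: A^{*cop} → A the Hopf isomorphism p ↦ (p⊗I)(R), and F: G×G → k* the non-degenerate skew-symmetric bilinear form F(g,h) := ⟨f_R⁻¹(g), h⟩. For g ∈ G let V_g be a ⟨g⟩-stable complement of sp_k{1−g} in P_{1,g}(A). Then for any a ∈ G and x ∈ V_g, one has xa = F(a,g)ax. -/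
open TensorProduct

noncomputable section

universe u v w

namespace Paper

variable (k : Type*) [Field k]

/-- The trace of left multiplication on `C ⊗ C`, relative to the first factor. -/
theorem trace_tmul {k C : Type*} [Field k] [CommRing C] [Algebra k C] [FiniteDimensional k C]
    (c d : C) :
    Algebra.trace C (C ⊗[k] C) (c ⊗ₜ d) = Algebra.trace k C d • c := by
  have h : (c ⊗ₜ[k] d : C ⊗[k] C) = c • (1 ⊗ₜ[k] d) := by simp [smul_tmul']
  have h' : Algebra.lmul C (C ⊗[k] C) ((1 : C) ⊗ₜ[k] d) = (Algebra.lmul k C d).baseChange C := by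
    ext; simp
  rw [h, map_smul, Algebra.trace_apply C, Algebra.trace_apply k]
  change c • LinearMap.trace C _ (Algebra.lmul C (C ⊗[k] C) ((1 : C) ⊗ₜ[k] d)) = _
  rw [h', LinearMap.trace_baseChange]
  simp [Algebra.smul_def, mul_comm]

/-- In a finite-dimensional commutative bialgebra over a field of characteristic zero, generated by
an invertible grouplike element `g` and a skew primitive element `x`, the trace of the regular
representation is an integral, so `x` is a multiple of `1 - g`. -/
theorem exists_eq_smul_one_sub_of_adjoin_eq_top {k C : Type*} [Field k] [CharZero k]
    [CommRing C] [Algebra k C] [FiniteDimensional k C] [Nontrivial C] (δ : C →ₐ[k] C ⊗[k] C)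
    {g u x : C} (hgu : g * u = 1) (hg : δ g = g ⊗ₜ g) (hu : δ u = u ⊗ₜ u)
    (hx : δ x = x ⊗ₜ 1 + g ⊗ₜ x) (htop : Algebra.adjoin k {g, u, x} = ⊤) :
    ∃ c : k, x = c • (1 - g) := by
  let φ : C ⊗[k] C →ₐ[C] C ⊗[k] C :=
    Algebra.TensorProduct.lift (Algebra.ofId C (C ⊗[k] C)) δ (fun _ _ => Commute.all _ _)
  have hφ (a b : C) : φ (a ⊗ₜ b) = a • δ b := by
    simp [φ, Algebra.smul_def, Algebra.ofId_apply]
  have hadj : (Algebra.adjoin k {g, u, x}).map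
      (Algebra.TensorProduct.includeRight : C →ₐ[k] C ⊗[k] C) ≤ φ.range.restrictScalars k := by
    rw [← Algebra.adjoin_image, Algebra.adjoin_le_iff]
    rintro _ ⟨y, rfl | rfl | rfl, rfl⟩
    · refine ⟨u ⊗ₜ y, ?_⟩
      simp [hφ, hg, smul_tmul', mul_comm u, hgu]
    · refine ⟨g ⊗ₜ y, ?_⟩
      simp [hφ, hu, smul_tmul', hgu]
    · refine ⟨u ⊗ₜ y - (u * y) ⊗ₜ 1, ?_⟩
      simp [hφ, hx, smul_tmul', mul_comm u, hgu, Algebra.TensorProduct.one_def]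
  have hsurj : Function.Surjective φ := by
    intro w
    induction w with
    | zero => exact ⟨0, map_zero _⟩
    | add a b ha hb =>
      obtain ⟨a, rfl⟩ := ha
      obtain ⟨b, rfl⟩ := hb
      exact ⟨a + b, map_add _ _ _⟩
    | tmul a b =>
      obtain ⟨w, hw⟩ := hadj ⟨b, by rw [htop]; trivial, rfl⟩
      refine ⟨a • w, ?_⟩
      have hw' : φ w = 1 ⊗ₜ b := hw
      rw [map_smul, hw', smul_tmul', smul_eq_mul, mul_one]
  have hinj : Function.Injective φ :=
    (LinearMap.injective_iff_surjective (f := φ.toLinearMap.restrictScalars k)).2 hsurj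
  let e := AlgEquiv.ofBijective φ ⟨hinj, hsurj⟩
  have key : Algebra.trace C (C ⊗[k] C) (δ x) = Algebra.trace C (C ⊗[k] C) ((1 : C) ⊗ₜ x) := by
    rw [← Algebra.trace_eq_of_algEquiv e ((1 : C) ⊗ₜ x)]
    exact congrArg _ ((hφ 1 x).trans (one_smul C _)).symm
  rw [hx, map_add, trace_tmul, trace_tmul, trace_tmul, ← map_one (algebraMap k C),
    Algebra.trace_algebraMap] at key
  have hn : (Module.finrank k C : k) ≠ 0 := Nat.cast_ne_zero.2 Module.finrank_pos.ne'
  refine ⟨(Module.finrank k C : k)⁻¹ * Algebra.trace k C x, ?_⟩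
  rw [mul_smul, smul_sub, ← map_one (algebraMap k C), ← key, nsmul_one, add_sub_cancel_right,
    smul_smul, inv_mul_cancel₀ hn, one_smul]

open scoped IsMulCommutative in
/-- In a finite-dimensional bialgebra over a field of characteristic zero, a skew primitive element
`x ∈ P_{1,g}` commuting with the invertible grouplike element `g` is a multiple of `1 - g`. -/
theorem exists_eq_smul_one_sub_of_commute {k A : Type*} [Field k] [CharZero k]
    [Ring A] [Bialgebra k A] [FiniteDimensional k A] {g u x : A}
    (hgu : g * u = 1) (hug : u * g = 1) (hgx : x * g = g * x)
    (hg : Coalgebra.comul (R := k) g = g ⊗ₜ g)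
    (hx : Coalgebra.comul (R := k) x = x ⊗ₜ 1 + g ⊗ₜ x) : ∃ c : k, x = c • (1 - g) := by
  have hu : Coalgebra.comul (R := k) u = u ⊗ₜ u := by
    have h1 : Coalgebra.comul (R := k) u * g ⊗ₜ[k] g = 1 := by
      rw [← hg, ← Bialgebra.comul_mul, hug, Bialgebra.comul_one]
    have h2 : (g ⊗ₜ[k] g) * (u ⊗ₜ[k] u) = 1 := by
      simp [hgu, Algebra.TensorProduct.one_def]
    exact left_inv_eq_right_inv h1 h2
  have hux : x * u = u * x :=
    calc x * u = u * g * x * u := by rw [hug, one_mul]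
      _ = u * x := by rw [mul_assoc u, ← hgx, mul_assoc, mul_assoc, hgu, mul_one]
  have hcomm : ∀ a ∈ ({g, u, x} : Set A), ∀ b ∈ ({g, u, x} : Set A), a * b = b * a := by
    rintro a (rfl | rfl | rfl) b (rfl | rfl | rfl) <;> simp_all
  have := Algebra.isMulCommutative_adjoin k hcomm
  set C := Algebra.adjoin k ({g, u, x} : Set A) with hC
  have hgC : g ∈ C := Algebra.subset_adjoin (by simp)
  have huC : u ∈ C := Algebra.subset_adjoin (by simp)
  have hxC : x ∈ C := Algebra.subset_adjoin (by simp)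
  cases subsingleton_or_nontrivial A
  · exact ⟨0, Subsingleton.elim _ _⟩
  let ι : C ⊗[k] C →ₐ[k] A ⊗[k] A := Algebra.TensorProduct.map C.val C.val
  have hι : Function.Injective ι :=
    TensorProduct.map_injective_of_flat_flat _ _ Subtype.val_injective Subtype.val_injective
  have hrange : C ≤ ι.range.comap (Bialgebra.comulAlgHom k A) := by
    refine Algebra.adjoin_le_iff.2 ?_
    rintro _ (rfl | rfl | rfl)
    · exact ⟨⟨_, hgC⟩ ⊗ₜ ⟨_, hgC⟩, by simp [ι, hg]⟩
    · exact ⟨⟨_, huC⟩ ⊗ₜ ⟨_, huC⟩, by simp [ι, hu]⟩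
    · exact ⟨⟨_, hxC⟩ ⊗ₜ 1 + ⟨_, hgC⟩ ⊗ₜ ⟨_, hxC⟩, by simp [ι, hx]⟩
  let δ : C →ₐ[k] C ⊗[k] C := (AlgEquiv.ofInjective ι hι).symm.toAlgHom.comp
    (((Bialgebra.comulAlgHom k A).comp C.val).codRestrict ι.range fun c => hrange c.2)
  have hδ (c : C) : ι (δ c) = Coalgebra.comul (R := k) (c : A) := by
    have := (AlgEquiv.ofInjective ι hι).apply_symm_apply
      (((Bialgebra.comulAlgHom k A).comp C.val).codRestrict ι.range (fun c => hrange c.2) c)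
    exact congrArg Subtype.val this
  have htop : Algebra.adjoin k ({⟨g, hgC⟩, ⟨u, huC⟩, ⟨x, hxC⟩} : Set C) = ⊤ := by
    rw [← Algebra.adjoin_adjoin_coe_preimage]
    congr 1
    ext ⟨y, hy⟩
    simp
  have hδg : δ ⟨g, hgC⟩ = ⟨g, hgC⟩ ⊗ₜ ⟨g, hgC⟩ := hι (by rw [hδ]; simp [ι, hg])
  have hδu : δ ⟨u, huC⟩ = ⟨u, huC⟩ ⊗ₜ ⟨u, huC⟩ := hι (by rw [hδ]; simp [ι, hu])
  have hδx : δ ⟨x, hxC⟩ = ⟨x, hxC⟩ ⊗ₜ 1 + ⟨g, hgC⟩ ⊗ₜ ⟨x, hxC⟩ :=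
    hι (by rw [hδ]; simp [ι, hx])
  obtain ⟨c, hc⟩ := exists_eq_smul_one_sub_of_adjoin_eq_top δ (Subtype.ext hgu) hδg hδu hδx htop
  exact ⟨c, congrArg Subtype.val hc⟩

section RMatrix

variable {k} {A : Type*} [Ring A] [HopfAlgebra k A]

/-- The contraction `a ⊗ b ↦ p(a) b`. -/
def sliceFst (p : Module.Dual k A) : A ⊗[k] A →ₗ[k] A :=
  (TensorProduct.lid k A).toLinearMap ∘ₗ p.rTensor A

/-- The contraction `a ⊗ b ↦ q(b) a`. -/
def sliceSnd (q : Module.Dual k A) : A ⊗[k] A →ₗ[k] A :=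
  (TensorProduct.rid k A).toLinearMap ∘ₗ q.lTensor A

@[simp] theorem sliceFst_tmul (p : Module.Dual k A) (a b : A) :
    sliceFst p (a ⊗ₜ[k] b) = p a • b := by simp [sliceFst]

@[simp] theorem sliceSnd_tmul (q : Module.Dual k A) (a b : A) :
    sliceSnd q (a ⊗ₜ[k] b) = q b • a := by simp [sliceSnd]

theorem eq_zero_of_sliceFst_eq_zero {w : A ⊗[k] A} (h : ∀ p, sliceFst p w = 0) : w = 0 := by
  classical
  let b := Module.Basis.ofVectorSpace k A
  apply (TensorProduct.equivFinsuppOfBasisLeft b).injective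
  rw [map_zero]
  ext i
  have : (TensorProduct.equivFinsuppOfBasisLeft (N := A) b w) i = sliceFst (b.coord i) w := by
    clear h
    induction w with
    | zero => simp
    | add x y hx hy => simp_all
    | tmul x y => simp
  rw [this, h, Finsupp.zero_apply]

theorem sliceSnd_comm (q : Module.Dual k A) (w : A ⊗[k] A) :
    sliceSnd q (TensorProduct.comm k A A w) = sliceFst q w := by
  induction w with
  | zero => simp
  | add x y hx hy => simp_all
  | tmul x y => simp

theorem sliceFst_comm (q : Module.Dual k A) (w : A ⊗[k] A) :
    sliceFst q (TensorProduct.comm k A A w) = sliceSnd q w := by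
  induction w with
  | zero => simp
  | add x y hx hy => simp_all
  | tmul x y => simp

theorem sliceFst_map (p : Module.Dual k A) (f h : A →ₗ[k] A) (w : A ⊗[k] A) :
    sliceFst p (TensorProduct.map f h w) = h (sliceFst (p ∘ₗ f) w) := by
  induction w with
  | zero => simp
  | add x y hx hy => simp_all
  | tmul x y => simp

theorem sliceSnd_map (p : Module.Dual k A) (f h : A →ₗ[k] A) (w : A ⊗[k] A) :
    sliceSnd p (TensorProduct.map f h w) = f (sliceSnd (p ∘ₗ h) w) := by
  induction w with
  | zero => simp
  | add x y hx hy => simp_all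
  | tmul x y => simp

theorem apply_sliceSnd (p q : Module.Dual k A) (w : A ⊗[k] A) :
    p (sliceSnd q w) = q (sliceFst p w) := by
  induction w with
  | zero => simp
  | add x y hx hy => simp_all
  | tmul x y => simp [mul_comm]

/-- If all slices of `w` lie in `K`, then `w ∈ K ⊗ K`. -/
theorem memTensorSquare_of_slices {K : Submodule k A} {w : A ⊗[k] A}
    (h₁ : ∀ p, sliceFst p w ∈ K) (h₂ : ∀ q, sliceSnd q w ∈ K) : MemTensorSquare k A K w := by
  obtain ⟨π, hπ⟩ := K.subtype.exists_leftInverse_of_injective K.ker_subtype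
  have hK (x : A) (hx : x ∈ K) : K.subtype (π x) = x :=
    congrArg K.subtype (LinearMap.congr_fun hπ ⟨x, hx⟩)
  have e₁ : TensorProduct.map LinearMap.id (K.subtype ∘ₗ π) w = w := by
    rw [← sub_eq_zero]
    refine eq_zero_of_sliceFst_eq_zero fun p => ?_
    rw [map_sub, sliceFst_map, LinearMap.comp_id, LinearMap.comp_apply, hK _ (h₁ p), sub_self]
  have e₂ : TensorProduct.map (K.subtype ∘ₗ π) LinearMap.id w = w := by
    rw [← sub_eq_zero, ← (TensorProduct.comm k A A).map_eq_zero_iff]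
    refine eq_zero_of_sliceFst_eq_zero fun p => ?_
    rw [sliceFst_comm, map_sub, sliceSnd_map, LinearMap.comp_id, LinearMap.comp_apply,
      hK _ (h₂ p), sub_self]
  refine ⟨TensorProduct.map π π w, ?_⟩
  rw [← LinearMap.comp_apply, ← TensorProduct.map_comp]
  conv_rhs => rw [← e₁, ← e₂]
  rw [← LinearMap.comp_apply, ← TensorProduct.map_comp, LinearMap.id_comp, LinearMap.comp_id]

theorem fR_eq_sliceFst (Q : QuasiTriangular k A) (p : Module.Dual k A) :
    fR k Q p = sliceFst p Q.R := by
  unfold fR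
  generalize Q.R = w
  induction w with
  | zero => simp
  | add x y hx hy => simp_all
  | tmul x y => simp

theorem hexagon₁_sum {w : A ⊗[k] A} (h : Hexagon₁ k A w) {s : Finset (A × A)}
    (hs : w = ∑ i ∈ s, i.1 ⊗ₜ[k] i.2) :
    ∑ i ∈ s, Coalgebra.comul (R := k) i.1 ⊗ₜ[k] i.2 =
      ∑ i ∈ s, ∑ j ∈ s, (i.1 ⊗ₜ[k] j.1) ⊗ₜ[k] (i.2 * j.2) := by
  simpa [Hexagon₁, hs, Finset.sum_mul_sum] using h

theorem hexagon₂_sum {w : A ⊗[k] A} (h : Hexagon₂ k A w) {s : Finset (A × A)}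
    (hs : w = ∑ i ∈ s, i.1 ⊗ₜ[k] i.2) :
    ∑ i ∈ s, i.1 ⊗ₜ[k] Coalgebra.comul (R := k) i.2 =
      ∑ i ∈ s, ∑ j ∈ s, (i.1 * j.1) ⊗ₜ[k] (j.2 ⊗ₜ[k] i.2) := by
  simpa [Hexagon₂, hs, Finset.sum_mul_sum] using h

theorem sliceFst_counit (Q : QuasiTriangular k A) :
    sliceFst (Coalgebra.counit (R := k)) Q.R = 1 := by
  obtain ⟨s, hs⟩ := TensorProduct.exists_finset Q.R
  have h := congrArg (TensorProduct.map ((TensorProduct.lid k A).toLinearMap ∘ₗ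
    (Coalgebra.counit (R := k) (A := A)).rTensor A) LinearMap.id) (hexagon₁_sum Q.hexagon₁ hs)
  have h' : (1 : A ⊗[k] A) * Q.R =
      (1 ⊗ₜ[k] sliceFst (Coalgebra.counit (R := k)) Q.R) * Q.R := by
    rw [one_mul]
    conv_lhs => rw [hs]
    conv_rhs => rw [hs]
    simpa [TensorProduct.tmul_sum, Finset.sum_mul_sum, TensorProduct.smul_tmul'] using h
  have h'' := congrArg (sliceFst (Coalgebra.counit (R := k))) (Q.isUnit.mul_right_cancel h')
  simpa [Algebra.TensorProduct.one_def] using h''.symm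

theorem comm_R_eq (Q : QuasiTriangular k A) (htri : Q.IsTriangular) :
    TensorProduct.comm k A A Q.R =
      TensorProduct.map (HopfAlgebra.antipode k) LinearMap.id Q.R := by
  refine (left_inv_eq_right_inv ?_ htri).symm
  obtain ⟨s, hs⟩ := TensorProduct.exists_finset Q.R
  have h := congrArg (TensorProduct.map (LinearMap.mul' k A ∘ₗ
    (HopfAlgebra.antipode k).rTensor A) LinearMap.id) (hexagon₁_sum Q.hexagon₁ hs)
  have h1 := congrArg (fun z => (1 : A) ⊗ₜ[k] z) (sliceFst_counit Q)
  simp only [hs] at h1 ⊢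
  simp only [map_sum, TensorProduct.map_tmul, LinearMap.comp_apply,
    HopfAlgebra.mul_antipode_rTensor_comul_apply, LinearMap.rTensor_tmul, LinearMap.mul'_apply,
    LinearMap.id_apply] at h
  simp only [map_sum, TensorProduct.map_tmul, Finset.sum_mul_sum,
    Algebra.TensorProduct.tmul_mul_tmul, LinearMap.id_apply]
  rw [← h, Algebra.TensorProduct.one_def, ← h1]
  simp [TensorProduct.tmul_sum, Algebra.algebraMap_eq_smul_one, TensorProduct.smul_tmul]

theorem sliceFst_mul (Q : QuasiTriangular k A) (p q : Module.Dual k A) :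
    sliceFst p Q.R * sliceFst q Q.R =
      sliceFst (LinearMap.mul' k k ∘ₗ TensorProduct.map p q ∘ₗ Coalgebra.comul) Q.R := by
  obtain ⟨s, hs⟩ := TensorProduct.exists_finset Q.R
  have h := congrArg ((TensorProduct.lid k A).toLinearMap ∘ₗ (LinearMap.mul' k k ∘ₗ
    TensorProduct.map p q).rTensor A) (hexagon₁_sum Q.hexagon₁ hs)
  simp only [hs]
  simpa [Finset.sum_mul_sum, smul_smul, mul_comm] using h.symm

theorem sliceSnd_mul (Q : QuasiTriangular k A) (p q : Module.Dual k A) :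
    sliceSnd p Q.R * sliceSnd q Q.R =
      sliceSnd (LinearMap.mul' k k ∘ₗ TensorProduct.map q p ∘ₗ Coalgebra.comul) Q.R := by
  obtain ⟨s, hs⟩ := TensorProduct.exists_finset Q.R
  have h := congrArg ((TensorProduct.rid k A).toLinearMap ∘ₗ (LinearMap.mul' k k ∘ₗ
    TensorProduct.map q p).lTensor A) (hexagon₂_sum Q.hexagon₂ hs)
  simp only [hs]
  simpa [Finset.sum_mul_sum, smul_smul, mul_comm] using h.symm

theorem comul_sliceFst (Q : QuasiTriangular k A) (p : Module.Dual k A) {s : Finset (A × A)}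
    (hs : Q.R = ∑ i ∈ s, i.1 ⊗ₜ[k] i.2) :
    Coalgebra.comul (R := k) (sliceFst p Q.R) =
      ∑ i ∈ s, ∑ j ∈ s, p (i.1 * j.1) • (j.2 ⊗ₜ[k] i.2) := by
  have h := congrArg ((TensorProduct.lid k (A ⊗[k] A)).toLinearMap ∘ₗ p.rTensor (A ⊗[k] A))
    (hexagon₂_sum Q.hexagon₂ hs)
  simpa [hs] using h

/-- For a minimal triangular Hopf algebra, both contraction maps `A* → A` of `R` are onto; in
particular `A` is finite-dimensional. -/
theorem slices_surjective (Q : QuasiTriangular k A) (htri : Q.IsTriangular) (hmin : Q.IsMinimal) :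
    FiniteDimensional k A ∧ (∀ a, ∃ p, sliceFst p Q.R = a) ∧ ∀ a, ∃ q, sliceSnd q Q.R = a := by
  classical
  obtain ⟨s, hs⟩ := TensorProduct.exists_finset Q.R
  let K := LinearMap.range (fR k Q)
  let L := LinearMap.range (fR k Q ∘ₗ (HopfAlgebra.antipode k (A := A)).dualMap)
  have hK (p) : sliceFst p Q.R ∈ K := ⟨p, fR_eq_sliceFst Q p⟩
  have hsnd (q) : fR k Q ((HopfAlgebra.antipode k (A := A)).dualMap q) = sliceSnd q Q.R := by
    rw [fR_eq_sliceFst, ← sliceFst_comm, comm_R_eq Q htri, sliceFst_map]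
    rfl
  have hfst (q) : sliceFst q Q.R = HopfAlgebra.antipode k (sliceSnd q Q.R) := by
    rw [← sliceSnd_comm, comm_R_eq Q htri, sliceSnd_map, LinearMap.comp_id]
  have : FiniteDimensional k K := by
    have hle : K ≤ Submodule.span k (s.image Prod.snd : Set A) := by
      rintro _ ⟨p, rfl⟩
      rw [fR_eq_sliceFst, hs, map_sum]
      refine sum_mem fun i hi => ?_
      rw [sliceFst_tmul]
      exact Submodule.smul_mem _ _ (Submodule.subset_span (by simpa using ⟨i.1, hi⟩))
    exact Submodule.finiteDimensional_of_le hle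
  have hLK : L ≤ K := by
    rintro _ ⟨q, rfl⟩
    exact ⟨_, rfl⟩
  have : FiniteDimensional k L := Submodule.finiteDimensional_of_le hLK
  have hKL : K ≤ L.map (HopfAlgebra.antipode k) := by
    rintro _ ⟨p, rfl⟩
    exact ⟨sliceSnd p Q.R, ⟨p, hsnd p⟩, by rw [fR_eq_sliceFst, hfst]⟩
  have hL : L = K := Submodule.eq_of_le_of_finrank_le hLK
    ((Submodule.finrank_mono hKL).trans (Submodule.finrank_map_le _ _))
  have hanti : K = K.map (HopfAlgebra.antipode k) :=
    Submodule.eq_of_le_of_finrank_le (hL ▸ hKL) (Submodule.finrank_map_le _ _)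
  have hR : MemTensorSquare k A K Q.R :=
    memTensorSquare_of_slices hK fun q => hL ▸ ⟨q, hsnd q⟩
  have hone : (1 : A) ∈ K := sliceFst_counit Q ▸ hK _
  let B : Subalgebra k A :=
    { K with
      mul_mem' := by
        rintro _ _ ⟨p, rfl⟩ ⟨q, rfl⟩
        rw [fR_eq_sliceFst, fR_eq_sliceFst, sliceFst_mul]
        exact hK _
      one_mem' := hone
      algebraMap_mem' := fun r => by
        rw [Algebra.algebraMap_eq_smul_one]
        exact K.smul_mem _ hone }
  have hB : IsSubHopf k A B := by
    refine ⟨?_, fun x hx => ?_⟩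
    · rintro _ ⟨p, rfl⟩
      obtain ⟨w, hw⟩ := hR
      obtain ⟨t, ht⟩ := TensorProduct.exists_finset w
      have ht' : Q.R = ∑ i ∈ t.image (Prod.map K.subtype K.subtype), i.1 ⊗ₜ[k] i.2 := by
        rw [Finset.sum_image fun _ _ _ _ h =>
          Prod.map_injective.2 ⟨K.subtype_injective, K.subtype_injective⟩ h, ← hw, ht]
        simp
      rw [fR_eq_sliceFst, comul_sliceFst Q p ht']
      refine sum_mem fun i hi => sum_mem fun j hj => Submodule.smul_mem _ _ ?_
      obtain ⟨i, -, rfl⟩ := Finset.mem_image.1 hi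
      obtain ⟨j, -, rfl⟩ := Finset.mem_image.1 hj
      exact ⟨j.2 ⊗ₜ i.2, rfl⟩
    · have : HopfAlgebra.antipode k x ∈ K.map (HopfAlgebra.antipode k) := ⟨x, hx, rfl⟩
      rwa [← hanti] at this
  have htop : K = ⊤ := by
    rw [eq_top_iff]
    intro x _
    have : x ∈ B := by
      rw [hmin B hB hR]
      trivial
    exact this
  have hmem (a : A) : a ∈ K := htop ▸ Submodule.mem_top
  refine ⟨?_, fun a => ?_, fun a => ?_⟩
  · have : FiniteDimensional k (⊤ : Submodule k A) := htop ▸ ‹FiniteDimensional k K›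
    exact Module.finite_def.2 (Module.Finite.iff_fg.1 this)
  · obtain ⟨p, hp⟩ := hmem a
    exact ⟨p, fR_eq_sliceFst Q p ▸ hp⟩
  · obtain ⟨q, hq⟩ : a ∈ L := hL ▸ hmem a
    exact ⟨q, hsnd q ▸ hq⟩

/-- A functional mapped by `f_R` to a grouplike element is multiplicative. -/
theorem map_mul_of_sliceFst_grouplike (Q : QuasiTriangular k A)
    (hsurj : ∀ a, ∃ q, sliceSnd q Q.R = a) {a : A} (ha : IsGrouplike k A a)
    {p : Module.Dual k A} (hp : sliceFst p Q.R = a) (x y : A) : p (x * y) = p x * p y := by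
  obtain ⟨q, rfl⟩ := hsurj x
  obtain ⟨q', rfl⟩ := hsurj y
  rw [sliceSnd_mul, apply_sliceSnd, apply_sliceSnd, apply_sliceSnd, hp]
  simp [ha.2, mul_comm]

theorem map_one_of_sliceFst_grouplike (Q : QuasiTriangular k A)
    (hsurj : ∀ a, ∃ q, sliceSnd q Q.R = a) {a : A} (ha : IsGrouplike k A a)
    {p : Module.Dual k A} (hp : sliceFst p Q.R = a) : p 1 = 1 := by
  have hmul := map_mul_of_sliceFst_grouplike Q hsurj ha hp
  obtain ⟨y, hy⟩ : ∃ y, p y ≠ 0 := by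
    by_contra! h
    have h0 : p = 0 := LinearMap.ext h
    have h1 := ha.1
    rw [← hp, h0] at h1
    simp [sliceFst] at h1
  have h := hmul 1 y
  rw [one_mul] at h
  exact (mul_right_cancel₀ hy ((one_mul _).trans h)).symm

/-- Applying a multiplicative functional `p` to `Δᶜᵒᵖ(x) R = R Δ(x)`. -/
theorem sliceFst_intertwine (Q : QuasiTriangular k A) {p : Module.Dual k A}
    (hmul : ∀ x y, p (x * y) = p x * p y) (x : A) :
    sliceFst p (TensorProduct.comm k A A (Coalgebra.comul (R := k) x)) * sliceFst p Q.R =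
      sliceFst p Q.R * sliceFst p (Coalgebra.comul (R := k) x) := by
  have h (v w : A ⊗[k] A) : sliceFst p (v * w) = sliceFst p v * sliceFst p w := by
    induction v with
    | zero => simp
    | add v v' hv hv' => simp [add_mul, hv, hv']
    | tmul a b =>
      induction w with
      | zero => simp
      | add w w' hw hw' => simp [mul_add, hw, hw']
      | tmul c d => simp [hmul, smul_smul, mul_comm]
  rw [← h, ← h, Q.intertwine]

end RMatrix

theorem IsGrouplike.mul_antipode {A : Type*} [Ring A] [HopfAlgebra k A] {g : A}
    (hg : IsGrouplike k A g) : g * HopfAlgebra.antipode k g = 1 := by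
  simpa [hg.2, hg.1] using HopfAlgebra.mul_antipode_lTensor_comul_apply (R := k) g

theorem IsGrouplike.antipode_mul {A : Type*} [Ring A] [HopfAlgebra k A] {g : A}
    (hg : IsGrouplike k A g) : HopfAlgebra.antipode k g * g = 1 := by
  simpa [hg.2, hg.1] using HopfAlgebra.mul_antipode_rTensor_comul_apply (R := k) g

/-- Let `(A,R)` be a minimal triangular pointed Hopf algebra over an
algebraically closed field `k` of characteristic `0`, `G = G(A)`,
`f_R : A^{*cop} → A` the Hopf isomorphism `p ↦ (p ⊗ I)(R)`, and `F : G × G → k*` the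
non-degenerate skew-symmetric bilinear form `F(g,h) = ⟨f_R⁻¹(g), h⟩`. For `g ∈ G` let
`V_g` be a `⟨g⟩`-stable complement of `sp_k{1−g}` in `P_{1,g}(A)`. Then for any
`a ∈ G` and `x ∈ V_g`, one has `xa = F(a,g) ax`. -/
theorem complement_group_commutation_rule
    (k : Type u) [Field k] [IsAlgClosed k] [CharZero k]
    (A : Type v) [Ring A] [HopfAlgebra k A]
    (Q : QuasiTriangular k A) (htri : Q.IsTriangular) (hmin : Q.IsMinimal)
    (hpointed : IsPointed k A)
    (F : A → A → k)
    (hFdef : ∀ g h : A, IsGrouplike k A g → IsGrouplike k A h →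
      ∀ p : Module.Dual k A, fR k Q p = g → F g h = p h) :
    ∀ g a : A, IsGrouplike k A g → IsGrouplike k A a →
      ∀ Vg : Submodule k A, IsConjStableComplement k A g Vg →
        ∀ x ∈ Vg, x * a = F a g • (a * x) := by
  intro g a hg ha V ⟨hVle, hdisj, _, hstab⟩ x hxV
  obtain ⟨hfin, hfst, hsnd⟩ := slices_surjective Q htri hmin
  have hx : Coalgebra.comul (R := k) x = x ⊗ₜ 1 + g ⊗ₜ x := by
    simpa [skewPrimitives, sub_eq_zero] using hVle hxV
  have hgu := hg.mul_antipode
  have hug := hg.antipode_mul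
  set u := HopfAlgebra.antipode k g
  have hrule (b : A) (hb : IsGrouplike k A b) (p : Module.Dual k A) (hp : sliceFst p Q.R = b) :
      b * g = g * b ∧ x * b + p x • (g * b) = p x • b + F b g • (b * x) := by
    have hmul := map_mul_of_sliceFst_grouplike Q hsnd hb hp
    have hone := map_one_of_sliceFst_grouplike Q hsnd hb hp
    have hF : F b g = p g := hFdef b g hb hg p (by rw [fR_eq_sliceFst, hp])
    have hpg : p g ≠ 0 := left_ne_zero_of_mul_eq_one (b := p u) (by rw [← hmul, hgu, hone])
    have h₁ := sliceFst_intertwine Q hmul g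
    have h₂ := sliceFst_intertwine Q hmul x
    simp only [hg.2, hx, hp, map_add, TensorProduct.comm_tmul, sliceFst_tmul, hone, one_smul,
      add_mul, mul_add, smul_mul_assoc, mul_smul_comm, mul_one] at h₁ h₂
    exact ⟨(smul_right_injective A hpg h₁).symm, by rw [hF, h₂]⟩
  obtain ⟨pg, hpg⟩ := hfst g
  obtain ⟨pa, hpa⟩ := hfst a
  have hmul := map_mul_of_sliceFst_grouplike Q hsnd ha hpa
  have hone := map_one_of_sliceFst_grouplike Q hsnd ha hpa
  have hcomb : pg x • (1 - g) = x - F g g • (g * x * u) := by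
    have h := congrArg (· * u) (hrule g hg pg hpg).2
    simp only [add_mul, smul_mul_assoc, mul_assoc, hgu, mul_one] at h
    rw [smul_sub, mul_assoc, sub_eq_sub_iff_add_eq_add, ← h, add_comm]
  have hzero : x = F g g • (g * x * u) := by
    rw [← sub_eq_zero, ← hcomb]
    exact Submodule.disjoint_def.1 hdisj _
      (Submodule.smul_mem _ _ (Submodule.mem_span_singleton_self _))
      (hcomb ▸ V.sub_mem hxV (V.smul_mem _ (hstab x hxV)))
  have hpx : pa x = 0 := by
    by_cases hF : F g g = 1
    · have hgx : x * g = g * x := by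
        conv_lhs => rw [hzero, hF, one_smul, mul_assoc, hug, mul_one]
      obtain ⟨c, hc⟩ := exists_eq_smul_one_sub_of_commute hgu hug hgx hg.2 hx
      rw [Submodule.disjoint_def.1 hdisj x (hc ▸ Submodule.smul_mem _ _
        (Submodule.mem_span_singleton_self _)) hxV, map_zero]
    · have h : pa x = F g g * pa x := by
        conv_lhs => rw [hzero]
        rw [map_smul, hmul, hmul, mul_right_comm, ← hmul, hgu, hone, one_mul, smul_eq_mul]
      have h' : (1 - F g g) * pa x = 0 := by linear_combination h
      exact (mul_eq_zero.1 h').resolve_left (sub_ne_zero.2 (Ne.symm hF))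
  simpa [hpx] using (hrule a ha pa hpa).2

end Paper
end
end
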